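/- arXiv:2102.02801 — 2 statements merged into one kernel-verified Lean document; each statement's English description precedes it below -/
import Mathlib

section
/- For every epsilon ∈ (0,1) and every delta > 0, there exist a set A ⊆ ℕ of lower natural density at least 1 − epsilon (i.e. liminf_n |A ∩ {1,...,n}|/n ≥ 1 − epsilon) and constants c_delta, C_{delta,epsilon} > 0 such that for every finite Abelian group G with |G| ∈ A and |G| ≥ 2, and every integer k ≥ (1 + delta)·d(G), if Z_1, ..., Z_k are i.i.d. uniform on G then P( t_rel^*(G^−(Z)) ≤ C_{delta,epsilon}·|G|^{2/k} ) ≥ 1 − C_{delta,epsilon}·2^{−k/c_delta}. -/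
/-- Transition matrix of the simple random walk on the undirected Cayley multigraph of the
finite additive Abelian group `G` with generator tuple `z`:
`P(x,y) = (2k)⁻¹·(#{i : y = x + z i} + #{i : y = x − z i})`. -/
noncomputable def cayP {G : Type*} [AddCommGroup G] [Fintype G] [DecidableEq G] {k : ℕ}
    (z : Fin k → G) (x y : G) : ℝ :=
  (((Finset.univ.filter fun i => y = x + z i).card : ℝ) +
    ((Finset.univ.filter fun i => y = x - z i).card : ℝ)) / (2 * k)

/-- The second-largest eigenvalue `λ₂` of a symmetric stochastic matrix `P` on `G`,
via the variational characterisation over mean-zero functions. -/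
noncomputable def lamTwo {G : Type*} [Fintype G] (P : G → G → ℝ) : ℝ :=
  sSup {r : ℝ | ∃ f : G → ℝ, f ≠ 0 ∧ (∑ x, f x) = 0 ∧
    r = (∑ x, ∑ y, f x * P x y * f y) / (∑ x, (f x) ^ 2)}

/-- The smallest eigenvalue `λ_{|G|}` of a symmetric stochastic matrix `P` on `G`,
via the variational characterisation. -/
noncomputable def lamMin {G : Type*} [Fintype G] (P : G → G → ℝ) : ℝ :=
  sInf {r : ℝ | ∃ f : G → ℝ, f ≠ 0 ∧
    r = (∑ x, ∑ y, f x * P x y * f y) / (∑ x, (f x) ^ 2)}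

/-- The absolute spectral gap `γ_* = 1 − max{|λ₂|, |λ_{|G|}|}`. -/
noncomputable def absSpectralGap {G : Type*} [Fintype G] (P : G → G → ℝ) : ℝ :=
  1 - max |lamTwo P| |lamMin P|

/-- Minimal size of a generating subset of the additive group `G`. -/
noncomputable def minGenAdd (G : Type*) [AddCommGroup G] : ℕ :=
  sInf {n : ℕ | ∃ s : Finset G, s.card = n ∧ AddSubgroup.closure (s : Set G) = ⊤}

/-- Probability, over a uniformly random `k`-tuple of elements of `G`, of the event `p`. -/
noncomputable def tupleProb (G : Type*) [Fintype G] (k : ℕ) (p : (Fin k → G) → Prop) : ℝ :=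
  (Nat.card {z : Fin k → G // p z} : ℝ) / (Fintype.card G : ℝ) ^ k

/-- Each summand `exp (-r² (1 - cos (2πt)))` is dominated by two geometric terms. -/
lemma exp_neg_sq_mul_one_sub_cos_le (r t : ℝ) (h0 : 0 ≤ t) (h1 : t ≤ 1) :
    Real.exp (-(r ^ 2 * (1 - Real.cos (2 * Real.pi * t)))) ≤
      2 * Real.exp (-(4 * r * t)) + 2 * Real.exp (-(4 * r * (1 - t))) := by
  have hhalf : ∀ u : ℝ, 0 ≤ u → u ≤ 1 / 2 →
      Real.exp (-(r ^ 2 * (1 - Real.cos (2 * Real.pi * u)))) ≤ 2 * Real.exp (-(4 * r * u)) := by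
    intro u hu hu'
    have hpi := Real.pi_pos
    have hcos := Real.cos_le_one_sub_mul_cos_sq (x := 2 * Real.pi * u)
      (by rw [abs_of_nonneg (by positivity)]; nlinarith)
    have hq : 2 / Real.pi ^ 2 * (2 * Real.pi * u) ^ 2 = 8 * u ^ 2 := by
      field_simp; ring
    rw [hq] at hcos
    have hlog : (2 : ℝ) = Real.exp (Real.log 2) := (Real.exp_log (by norm_num)).symm
    rw [show 2 * Real.exp (-(4 * r * u)) = Real.exp (Real.log 2 + -(4 * r * u)) by
      rw [Real.exp_add, ← hlog]]
    apply Real.exp_le_exp.mpr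
    have := Real.log_two_gt_d9
    nlinarith [sq_nonneg (r * u - 1 / 4), sq_nonneg r,
      mul_le_mul_of_nonneg_left hcos (sq_nonneg r), sq_nonneg (r * u)]
  rcases le_total t (1 / 2) with h | h
  · have := hhalf t h0 h
    have := Real.exp_pos (-(4 * r * (1 - t)))
    linarith
  · have h2 := hhalf (1 - t) (by linarith) (by linarith)
    rw [show 2 * Real.pi * (1 - t) = 2 * Real.pi - 2 * Real.pi * t by ring,
      Real.cos_two_pi_sub] at h2
    have := Real.exp_pos (-(4 * r * t))
    linarith

lemma sum_range_exp_neg_mul_succ_le (a : ℝ) (ha : 0 < a) (n : ℕ) :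
    ∑ j ∈ Finset.range n, Real.exp (-(a * (j + 1 : ℕ))) ≤ 1 / a := by
  have hq : Real.exp (-a) < 1 := by rw [Real.exp_lt_one_iff]; linarith
  have hq0 := Real.exp_pos (-a)
  have key : ∀ n : ℕ, ∑ j ∈ Finset.range n, Real.exp (-(a * (j + 1 : ℕ)))
      ≤ (1 - Real.exp (-(a * n))) / a := by
    intro n
    induction n with
    | zero => simp
    | succ n ih =>
      rw [Finset.sum_range_succ]
      have h1 : Real.exp (-(a * n)) = Real.exp (-(a * (n + 1 : ℕ))) * Real.exp a := by
        rw [← Real.exp_add]; congr 1; push_cast; ring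
      have h2 := Real.add_one_le_exp a
      have h3 := Real.exp_pos (-(a * (n + 1 : ℕ)))
      rw [le_div_iff₀ ha] at ih ⊢
      nlinarith
  refine (key n).trans ?_
  gcongr
  have := Real.exp_pos (-(a * n))
  linarith

/-- Gaussian-type bound on the Laplace transform of `1 - cos` over the `m`-th roots of unity. -/
lemma sum_exp_neg_sq_mul_one_sub_cos_le (r : ℝ) (hr : 0 < r) (m : ℕ) (hm : 0 < m) :
    ∑ j ∈ Finset.range m, Real.exp (-(r ^ 2 * (1 - Real.cos (2 * Real.pi * (j / m))))) ≤
      1 + m / r := by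
  obtain ⟨n, rfl⟩ : ∃ n, m = n + 1 := ⟨m - 1, by omega⟩
  rw [Finset.sum_range_succ']
  set a : ℝ := 4 * r / (n + 1 : ℕ) with ha
  have ha0 : 0 < a := by positivity
  have hgeom := sum_range_exp_neg_mul_succ_le a ha0 n
  have hrefl : ∑ j ∈ Finset.range n, Real.exp (-(a * (n - j : ℕ))) =
      ∑ j ∈ Finset.range n, Real.exp (-(a * (j + 1 : ℕ))) := by
    rw [← Finset.sum_range_reflect]
    refine Finset.sum_congr rfl fun j hj => ?_
    rw [Finset.mem_range] at hj
    congr 4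
    omega
  have hterm : ∑ j ∈ Finset.range n,
      Real.exp (-(r ^ 2 * (1 - Real.cos (2 * Real.pi * ((j + 1 : ℕ) / (n + 1 : ℕ)))))) ≤
      ∑ j ∈ Finset.range n,
        (2 * Real.exp (-(a * (j + 1 : ℕ))) + 2 * Real.exp (-(a * (n - j : ℕ)))) := by
    refine Finset.sum_le_sum fun j hj => ?_
    rw [Finset.mem_range] at hj
    have := exp_neg_sq_mul_one_sub_cos_le r ((j + 1 : ℕ) / (n + 1 : ℕ)) (by positivity)
      (by rw [div_le_one (by positivity)]; exact_mod_cast (by omega : j + 1 ≤ n + 1))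
    refine this.trans (le_of_eq ?_)
    have hc : ((n - j : ℕ) : ℝ) = n - j := by push_cast [hj.le]; ring
    rw [hc, ha]
    have hn : ((n + 1 : ℕ) : ℝ) ≠ 0 := by positivity
    congr 4
    · ring
    · field_simp
      push_cast
      ring
  rw [Finset.sum_add_distrib, ← Finset.mul_sum, ← Finset.mul_sum, hrefl] at hterm
  have h4 : 1 / a = (n + 1 : ℕ) / r / 4 := by rw [ha]; field_simp
  simp only [Nat.cast_zero, zero_div, mul_zero, Real.cos_zero, sub_self, neg_zero, Real.exp_zero]
  linarith

section FiniteAbelian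

variable {G : Type*} [AddCommGroup G] [Fintype G]

/-- The fibres of a character of order `m` over `m`-th roots of unity have size `|G| / m`. -/
lemma AddChar.orderOf_mul_card_fiber [DecidableEq G] (χ : AddChar G ℂ) (w : ℂ)
    (hw : w ^ orderOf χ = 1) :
    orderOf χ * (Finset.univ.filter fun x => χ x = w).card = Fintype.card G := by
  have hm : 0 < orderOf χ := orderOf_pos χ
  have hw0 : w ≠ 0 := by rintro rfl; simp [hm.ne'] at hw
  have h1 : ∀ x, ∑ j ∈ Finset.range (orderOf χ), (χ x * w⁻¹) ^ j =
      if χ x = w then (orderOf χ : ℂ) else 0 := by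
    intro x
    split_ifs with h
    · simp [h, hw0]
    · have hne : χ x * w⁻¹ ≠ 1 := by
        intro h'
        apply h
        field_simp at h'
        exact h'
      have hpow : (χ x * w⁻¹) ^ orderOf χ = 1 := by
        rw [mul_pow, inv_pow, hw, ← AddChar.pow_apply, pow_orderOf_eq_one]; simp
      rw [geom_sum_eq hne, hpow]; simp
  have h2 : ∑ x, ∑ j ∈ Finset.range (orderOf χ), (χ x * w⁻¹) ^ j = (Fintype.card G : ℂ) := by
    rw [Finset.sum_comm, Finset.sum_eq_single_of_mem 0 (by simpa using hm)]
    · simp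
    · intro j hj hj0
      simp_rw [mul_pow, ← AddChar.pow_apply]
      rw [← Finset.sum_mul, AddChar.sum_eq_zero_iff_ne_zero.mpr, zero_mul]
      exact pow_ne_one_of_lt_orderOf hj0 (Finset.mem_range.mp hj)
  simp_rw [h1] at h2
  rw [← Finset.sum_filter, Finset.sum_const, nsmul_eq_mul] at h2
  have h3 : (orderOf χ : ℂ) * (Finset.univ.filter fun x => χ x = w).card = Fintype.card G := by
    rw [← h2]; ring
  exact_mod_cast h3

lemma AddChar.orderOf_mul_sum_le (χ : AddChar G ℂ) (h : ℂ → ℝ)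
    (hh : ∀ w, 0 ≤ h w) :
    orderOf χ * ∑ x, h (χ x) ≤ Fintype.card G * ∑ j ∈ Finset.range (orderOf χ),
      h (Complex.exp (2 * Real.pi * Complex.I / orderOf χ) ^ j) := by
  classical
  have hm : 0 < orderOf χ := orderOf_pos χ
  have hprim := Complex.isPrimitiveRoot_exp (orderOf χ) hm.ne'
  set ω := Complex.exp (2 * Real.pi * Complex.I / orderOf χ) with hω
  have h1 : ∑ x, h (χ x) ≤ ∑ x, ∑ j ∈ Finset.range (orderOf χ),
      if χ x = ω ^ j then h (ω ^ j) else 0 := by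
    refine Finset.sum_le_sum fun x _ => ?_
    have : NeZero (orderOf χ) := ⟨hm.ne'⟩
    obtain ⟨j, hj, hjx⟩ := hprim.eq_pow_of_pow_eq_one (ξ := χ x)
      (by rw [← AddChar.pow_apply, pow_orderOf_eq_one]; simp)
    refine le_trans ?_ (Finset.single_le_sum (f := fun j => if χ x = ω ^ j then h (ω ^ j) else 0)
      (fun i _ => by split_ifs <;> simp [hh]) (Finset.mem_range.mpr hj))
    simp [hjx]
  refine (mul_le_mul_of_nonneg_left h1 (Nat.cast_nonneg _)).trans (le_of_eq ?_)
  rw [Finset.sum_comm, Finset.mul_sum, Finset.mul_sum]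
  refine Finset.sum_congr rfl fun j _ => ?_
  rw [← Finset.sum_filter, Finset.sum_const, nsmul_eq_mul, ← mul_assoc]
  congr 1
  exact_mod_cast AddChar.orderOf_mul_card_fiber χ (ω ^ j)
    (by rw [← pow_mul, mul_comm, pow_mul, hprim.pow_eq_one, one_pow])

lemma AddChar.sum_exp_neg_one_sub_re_le (χ : AddChar G ℂ) (r : ℝ) (hr : 0 < r) :
    ∑ x, Real.exp (-(r ^ 2 * (1 - (χ x).re))) ≤
      Fintype.card G * (1 / orderOf χ + 1 / r) := by
  have hm : 0 < orderOf χ := orderOf_pos χ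
  have hm' : (0 : ℝ) < orderOf χ := by exact_mod_cast hm
  have h1 := AddChar.orderOf_mul_sum_le χ (fun w => Real.exp (-(r ^ 2 * (1 - w.re))))
    (fun w => (Real.exp_pos _).le)
  have h2 := sum_exp_neg_sq_mul_one_sub_cos_le r hr (orderOf χ) hm
  have h3 : ∀ j : ℕ, (Complex.exp (2 * Real.pi * Complex.I / orderOf χ) ^ j).re =
      Real.cos (2 * Real.pi * (j / orderOf χ)) := by
    intro j
    rw [← Complex.exp_nat_mul, ← Complex.exp_ofReal_mul_I_re]
    congr 2
    push_cast
    ring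
  simp only [h3] at h1
  have h4 := h1.trans (mul_le_mul_of_nonneg_left h2 (Nat.cast_nonneg _))
  refine le_of_mul_le_mul_left (h4.trans (le_of_eq ?_)) hm'
  field_simp
/-- Chernoff's bound, in counting form. -/
lemma card_sum_le_le_exp_mul_pow {X : Type*} [Fintype X] (g : X → ℝ) (k : ℕ) (a s : ℝ) (hs : 0 ≤ s)
    [DecidablePred fun z : Fin k → X => ∑ i, g (z i) ≤ a] :
    ((Finset.univ.filter fun z : Fin k → X => ∑ i, g (z i) ≤ a).card : ℝ) ≤
      Real.exp (s * a) * (∑ x, Real.exp (-(s * g x))) ^ k := by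
  rw [Fintype.sum_pow, Finset.mul_sum, ← nsmul_one, ← Finset.sum_const, Finset.sum_filter]
  refine Finset.sum_le_sum fun z _ => ?_
  rw [← Real.exp_sum, ← Real.exp_add]
  split_ifs with h
  · rw [Real.one_le_exp_iff, Finset.sum_neg_distrib, ← Finset.mul_sum]
    nlinarith
  · positivity

/-- A generating set of size `d` bounds the number of characters of exponent `m` by `m ^ d`. -/
lemma AddChar.card_orderOf_eq_le (s : Finset G) (hs : AddSubgroup.closure (s : Set G) = ⊤)
    (m : ℕ) (hm : 0 < m) :
    (Finset.univ.filter fun χ : AddChar G ℂ => orderOf χ = m).card ≤ m ^ s.card := by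
  classical
  have hroot : (Polynomial.nthRootsFinset m (1 : ℂ)).card ≤ m := by
    rw [(Complex.isPrimitiveRoot_exp m hm.ne').card_nthRootsFinset]
  calc _ ≤ (Fintype.piFinset fun _ : s => Polynomial.nthRootsFinset m (1 : ℂ)).card := by
        refine Finset.card_le_card_of_injOn (fun χ x => χ x) ?_ ?_
        · intro χ hχ
          simp only [Finset.coe_filter, Finset.mem_univ, true_and, Set.mem_ofPred_eq] at hχ
          simp only [Finset.mem_coe, Fintype.mem_piFinset]
          intro x
          rw [Polynomial.mem_nthRootsFinset hm, ← AddChar.pow_apply, ← hχ, pow_orderOf_eq_one]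
          simp
        · intro χ _ ψ _ h
          ext x
          have hx : x ∈ AddSubgroup.closure (s : Set G) := by rw [hs]; trivial
          induction hx using AddSubgroup.closure_induction with
          | mem y hy => exact congrFun h ⟨y, hy⟩
          | zero => simp
          | add y z _ _ hy hz => rw [AddChar.map_add_eq_mul, AddChar.map_add_eq_mul, hy, hz]
          | neg y _ hy => rw [AddChar.map_neg_eq_inv, AddChar.map_neg_eq_inv, hy]
    _ = (Polynomial.nthRootsFinset m (1 : ℂ)).card ^ s.card := by
        rw [Fintype.card_piFinset]; simp
    _ ≤ m ^ s.card := Nat.pow_le_pow_left hroot _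

/-- Plancherel's identity for the autocorrelation of a real function. -/
lemma AddChar.card_mul_sum_mul_shift (f : G → ℝ) (z : G) :
    (Fintype.card G : ℝ) * ∑ x, f x * f (x + z) =
      ∑ χ : AddChar G ℂ, ‖∑ x, (f x : ℂ) * χ x‖ ^ 2 * (χ z).re := by
  classical
  have key : ∑ χ : AddChar G ℂ, ((‖∑ x, (f x : ℂ) * χ x‖ ^ 2 : ℝ) : ℂ) * χ z =
      Fintype.card G * ∑ x, (f x : ℂ) * f (x + z) := by
    have h1 : ∀ χ : AddChar G ℂ, ((‖∑ x, (f x : ℂ) * χ x‖ ^ 2 : ℝ) : ℂ) * χ z =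
        ∑ x, ∑ y, (f x : ℂ) * f y * χ (x - y + z) := by
      intro χ
      rw [Complex.ofReal_pow, ← Complex.mul_conj', map_sum, Finset.sum_mul_sum, Finset.sum_mul]
      refine Finset.sum_congr rfl fun x _ => ?_
      rw [Finset.sum_mul]
      refine Finset.sum_congr rfl fun y _ => ?_
      rw [map_mul, Complex.conj_ofReal, ← AddChar.map_neg_eq_conj, AddChar.map_add_eq_mul,
        sub_eq_add_neg, AddChar.map_add_eq_mul]
      ring
    simp_rw [h1]
    rw [Finset.sum_comm, Finset.mul_sum]
    refine Finset.sum_congr rfl fun x _ => ?_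
    rw [Finset.sum_comm, Finset.sum_eq_single_of_mem (x + z) (Finset.mem_univ _)]
    · rw [← Finset.mul_sum, AddChar.sum_apply_eq_ite, if_pos (by abel)]
      ring
    · intro y _ hy
      rw [← Finset.mul_sum, AddChar.sum_apply_eq_ite, if_neg, mul_zero]
      intro h
      apply hy
      rw [← sub_eq_zero, ← neg_eq_zero, ← h]
      abel
  have h2 := congrArg Complex.re key
  rw [Complex.re_sum] at h2
  simp only [Complex.re_ofReal_mul] at h2
  rw [h2, ← Complex.ofReal_re (_ * ∑ x, f x * f (x + z))]
  push_cast
  rfl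

/-- Fourier expansion of the quadratic form of the random walk. -/
lemma card_mul_sum_cayP [DecidableEq G] {k : ℕ} (z : Fin k → G) (f : G → ℝ) :
    (Fintype.card G : ℝ) * ∑ x, ∑ y, f x * cayP z x y * f y =
      ∑ χ : AddChar G ℂ, ‖∑ x, (f x : ℂ) * χ x‖ ^ 2 * ((∑ i, (χ (z i)).re) / k) := by
  have hrow : ∀ x, ∑ y, f x * cayP z x y * f y =
      ∑ i, (f x * f (x + z i) + f x * f (x - z i)) / (2 * k) := by
    intro x
    have hxy : ∀ y, f x * cayP z x y * f y =
        ∑ i, ((if y = x + z i then f x * f y / (2 * k) else 0) +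
          if y = x - z i then f x * f y / (2 * k) else 0) := by
      intro y
      have hc : ∀ (p : Fin k → Prop) [DecidablePred p], ∑ i, (if p i then f x * f y / (2 * k) else 0)
          = ((Finset.univ.filter p).card : ℝ) * (f x * f y / (2 * k)) := by
        intro p _
        rw [← Finset.sum_filter, Finset.sum_const, nsmul_eq_mul]
      rw [Finset.sum_add_distrib, hc, hc, cayP]
      ring
    simp_rw [hxy]
    rw [Finset.sum_comm]
    refine Finset.sum_congr rfl fun i _ => ?_
    rw [Finset.sum_add_distrib, Finset.sum_ite_eq' , Finset.sum_ite_eq']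
    simp only [Finset.mem_univ, if_true]
    ring
  have hsymm : ∀ w : G, ∑ x, f x * f (x - w) = ∑ x, f x * f (x + w) := by
    intro w
    rw [← Equiv.sum_comp (Equiv.addRight w)]
    refine Finset.sum_congr rfl fun x _ => ?_
    simp [mul_comm]
  have hquad : ∑ x, ∑ y, f x * cayP z x y * f y = (∑ i, ∑ x, f x * f (x + z i)) / k := by
    simp_rw [hrow]
    rw [Finset.sum_comm, Finset.sum_div]
    refine Finset.sum_congr rfl fun i _ => ?_
    rw [← Finset.sum_div, Finset.sum_add_distrib, hsymm, ← two_mul]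
    rw [mul_div_mul_left _ _ two_ne_zero]
  rw [hquad, ← mul_div_assoc, Finset.mul_sum]
  simp_rw [AddChar.card_mul_sum_mul_shift]
  rw [Finset.sum_comm, Finset.sum_div]
  refine Finset.sum_congr rfl fun χ _ => ?_
  rw [← Finset.mul_sum, mul_div_assoc]

/-- Bounds on the Fourier eigenvalues give a bound on the absolute spectral gap. -/
lemma le_absSpectralGap_cayP [DecidableEq G] (hG : 2 ≤ Fintype.card G) {k : ℕ} (z : Fin k → G)
    (γ : ℝ) (hup : ∀ χ : AddChar G ℂ, χ ≠ 1 → (∑ i, (χ (z i)).re) / k ≤ 1 - γ)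
    (hlow : ∀ χ : AddChar G ℂ, -(1 - γ) ≤ (∑ i, (χ (z i)).re) / k) :
    γ ≤ absSpectralGap (cayP z) := by
  have hN : (0 : ℝ) < Fintype.card G := by exact_mod_cast (by omega : 0 < Fintype.card G)
  have hpars : ∀ f : G → ℝ, (Fintype.card G : ℝ) * ∑ x, f x ^ 2 =
      ∑ χ : AddChar G ℂ, ‖∑ x, (f x : ℂ) * χ x‖ ^ 2 := by
    intro f
    have := AddChar.card_mul_sum_mul_shift f 0
    simpa [← sq] using this
  have hpos : ∀ f : G → ℝ, f ≠ 0 → 0 < ∑ x, f x ^ 2 := by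
    intro f hf
    obtain ⟨x, hx⟩ := Function.ne_iff.mp hf
    exact Finset.sum_pos' (fun _ _ => sq_nonneg _) ⟨x, Finset.mem_univ _, by
      have : f x ≠ 0 := hx
      positivity⟩
  have hge : ∀ f : G → ℝ, f ≠ 0 →
      -(1 - γ) ≤ (∑ x, ∑ y, f x * cayP z x y * f y) / (∑ x, (f x) ^ 2) := by
    intro f hf
    rw [le_div_iff₀ (hpos f hf)]
    refine le_of_mul_le_mul_left ?_ hN
    rw [card_mul_sum_cayP, mul_left_comm, hpars, Finset.mul_sum]
    refine Finset.sum_le_sum fun χ _ => ?_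
    rw [mul_comm]
    exact mul_le_mul_of_nonneg_left (hlow χ) (sq_nonneg _)
  have hle : ∀ f : G → ℝ, f ≠ 0 → ∑ x, f x = 0 →
      (∑ x, ∑ y, f x * cayP z x y * f y) / (∑ x, (f x) ^ 2) ≤ 1 - γ := by
    intro f hf hf0
    rw [div_le_iff₀ (hpos f hf)]
    refine le_of_mul_le_mul_left ?_ hN
    rw [card_mul_sum_cayP, mul_left_comm, hpars, Finset.mul_sum]
    refine Finset.sum_le_sum fun χ _ => ?_
    rw [mul_comm (1 - γ)]
    by_cases hχ : χ = 1
    · have : ∑ x, (f x : ℂ) * χ x = 0 := by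
        simp only [hχ, AddChar.one_apply, mul_one]
        exact_mod_cast hf0
      rw [this]
      simp
    · exact mul_le_mul_of_nonneg_left (hup χ hχ) (sq_nonneg _)
  obtain ⟨f, hf, hf0⟩ : ∃ f : G → ℝ, f ≠ 0 ∧ ∑ x, f x = 0 := by
    obtain ⟨a, b, hab⟩ := Fintype.exists_pair_of_one_lt_card (by omega : 1 < Fintype.card G)
    refine ⟨Pi.single a 1 - Pi.single b 1, ?_, ?_⟩
    · intro h
      have := congrFun h a
      simp [hab] at this
    · simp
  set q := (∑ x, ∑ y, f x * cayP z x y * f y) / (∑ x, (f x) ^ 2) with hq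
  have h1 : lamTwo (cayP z) ≤ 1 - γ := by
    refine csSup_le ⟨q, f, hf, hf0, hq⟩ ?_
    rintro r ⟨g, hg, hg0, rfl⟩
    exact hle g hg hg0
  have h2 : q ≤ lamTwo (cayP z) := by
    refine le_csSup ⟨1 - γ, ?_⟩ ⟨f, hf, hf0, hq⟩
    rintro r ⟨g, hg, hg0, rfl⟩
    exact hle g hg hg0
  have h3 : -(1 - γ) ≤ lamMin (cayP z) := by
    refine le_csInf ⟨q, f, hf, hq⟩ ?_
    rintro r ⟨g, hg, rfl⟩
    exact hge g hg
  have h4 : lamMin (cayP z) ≤ q := by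
    refine csInf_le ⟨-(1 - γ), ?_⟩ ⟨f, hf, hq⟩
    rintro r ⟨g, hg, rfl⟩
    exact hge g hg
  have h5 := hge f hf
  have h6 := hle f hf hf0
  rw [absSpectralGap, le_sub_comm]
  exact max_le (abs_le.mpr ⟨by linarith, h1⟩) (abs_le.mpr ⟨h3, by linarith⟩)

/-- It suffices to keep all nontrivial characters away from `1` and the quadratic ones away
from `-1`: if `χ` is close to `-1` then `χ ^ 2` is close to `1`. -/
lemma le_absSpectralGap_cayP_of_lt [DecidableEq G] (hG : 2 ≤ Fintype.card G) {k : ℕ} (hk : 0 < k)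
    (z : Fin k → G) (η : ℝ) (hη : 0 ≤ η) (hη1 : η ≤ 1)
    (hone : ∀ χ : AddChar G ℂ, χ ≠ 1 → k * η < ∑ i, (1 - (χ (z i)).re))
    (hneg : ∀ χ : AddChar G ℂ, χ ≠ 1 → χ ^ 2 = 1 → k * η < ∑ i, (1 + (χ (z i)).re)) :
    η / 4 ≤ absSpectralGap (cayP z) := by
  have hk' : (0 : ℝ) < k := by exact_mod_cast hk
  refine le_absSpectralGap_cayP hG z _ (fun χ hχ => ?_) (fun χ => ?_)
  · have := hone χ hχ
    rw [Finset.sum_sub_distrib] at this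
    simp only [Finset.sum_const, Finset.card_univ, Fintype.card_fin, nsmul_eq_mul, mul_one] at this
    rw [div_le_iff₀ hk']
    nlinarith
  · by_cases h1 : χ = 1
    · simp only [h1, AddChar.one_apply, Complex.one_re, Finset.sum_const, Finset.card_univ,
        Fintype.card_fin, nsmul_eq_mul, mul_one, div_self hk'.ne']
      linarith
    · have key : k * η ≤ 4 * ∑ i, (1 + (χ (z i)).re) := by
        by_cases h2 : χ ^ 2 = 1
        · have := hneg χ h1 h2
          nlinarith
        · refine (hone _ h2).le.trans ?_
          rw [Finset.mul_sum]
          refine Finset.sum_le_sum fun i _ => ?_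
          have hn := AddChar.norm_apply χ (z i)
          have hsq : (χ (z i)).re ^ 2 + (χ (z i)).im ^ 2 = 1 := by
            rw [← Complex.normSq_add_mul_I, Complex.re_add_im, Complex.normSq_eq_norm_sq, hn]
            norm_num
          have hre : ((χ ^ 2) (z i)).re = (χ (z i)).re ^ 2 - (χ (z i)).im ^ 2 := by
            rw [AddChar.pow_apply, sq, Complex.mul_re]; ring
          rw [hre]
          nlinarith [sq_nonneg (1 + (χ (z i)).re)]
      rw [Finset.sum_add_distrib] at key
      simp only [Finset.sum_const, Finset.card_univ, Fintype.card_fin, nsmul_eq_mul, mul_one] at key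
      rw [le_div_iff₀ hk']
      nlinarith

/-- The Laplace transform at `-1` of a quadratic character equals the one at `1`. -/
lemma AddChar.sum_comp_neg_re_eq (χ : AddChar G ℂ) (h1 : χ ≠ 1) (h2 : χ ^ 2 = 1) (h : ℝ → ℝ) :
    ∑ x, h (1 + (χ x).re) = ∑ x, h (1 - (χ x).re) := by
  obtain ⟨a, ha⟩ := AddChar.ne_one_iff.mp h1
  have ha' : χ a = -1 := by
    have : (χ a) ^ 2 = 1 := by rw [← AddChar.pow_apply, h2]; simp
    exact (mul_self_eq_one_iff.mp (by rw [← sq, this])).resolve_left ha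
  rw [← Equiv.sum_comp (Equiv.addRight a)]
  refine Finset.sum_congr rfl fun x _ => ?_
  simp [AddChar.map_add_eq_mul, ha', sub_eq_add_neg]

/-- Union bound for the failure of the spectral gap. -/
lemma card_absSpectralGap_lt_le [DecidableEq G] (hG : 2 ≤ Fintype.card G) {k : ℕ} (hk : 0 < k)
    (r η : ℝ) (hr : 0 < r) (hη : 0 ≤ η) (hη1 : η ≤ 1)
    [DecidablePred fun z : Fin k → G => η / 4 ≤ absSpectralGap (cayP z)] :
    ((Finset.univ.filter fun z : Fin k → G => ¬ η / 4 ≤ absSpectralGap (cayP z)).card : ℝ) ≤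
      2 * (Fintype.card G : ℝ) ^ k * ∑ χ : AddChar G ℂ with χ ≠ 1,
        (Real.exp (r ^ 2 * η) * (1 / orderOf χ + 1 / r)) ^ k := by
  classical
  let B : AddChar G ℂ → Finset (Fin k → G) := fun χ =>
    Finset.univ.filter fun z => ∑ i, (1 - (χ (z i)).re) ≤ k * η
  let B' : AddChar G ℂ → Finset (Fin k → G) := fun χ =>
    Finset.univ.filter fun z => χ ^ 2 = 1 ∧ ∑ i, (1 + (χ (z i)).re) ≤ k * η
  have hsub : (Finset.univ.filter fun z : Fin k → G => ¬ η / 4 ≤ absSpectralGap (cayP z)) ⊆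
      (Finset.univ.filter fun χ : AddChar G ℂ => χ ≠ 1).biUnion fun χ => B χ ∪ B' χ := by
    intro z hz
    simp only [Finset.mem_filter, Finset.mem_univ, true_and] at hz
    by_contra hcon
    simp only [B, B', Finset.mem_biUnion, Finset.mem_union, Finset.mem_filter, Finset.mem_univ,
      true_and, not_exists, not_and, not_or, not_le] at hcon
    exact hz (le_absSpectralGap_cayP_of_lt hG hk z η hη hη1 (fun χ hχ => (hcon χ hχ).1)
      (fun χ hχ h2 => (hcon χ hχ).2 h2))
  have hlap : ∀ χ : AddChar G ℂ, ∀ S : ℝ, 0 ≤ S →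
      S ≤ Fintype.card G * (1 / orderOf χ + 1 / r) →
      Real.exp (r ^ 2 * (k * η)) * S ^ k ≤ (Fintype.card G : ℝ) ^ k *
        (Real.exp (r ^ 2 * η) * (1 / orderOf χ + 1 / r)) ^ k := by
    intro χ S hS0 hS
    rw [show r ^ 2 * (k * η) = k * (r ^ 2 * η) by ring, Real.exp_nat_mul, ← mul_pow, ← mul_pow]
    refine pow_le_pow_left₀ (by positivity) ?_ k
    rw [mul_left_comm]
    gcongr
  have hB : ∀ χ : AddChar G ℂ, ((B χ).card : ℝ) ≤ (Fintype.card G : ℝ) ^ k *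
      (Real.exp (r ^ 2 * η) * (1 / orderOf χ + 1 / r)) ^ k := fun χ =>
    (card_sum_le_le_exp_mul_pow (fun x => 1 - (χ x).re) k (k * η) (r ^ 2) (sq_nonneg r)).trans
      (hlap χ _ (by positivity) (AddChar.sum_exp_neg_one_sub_re_le χ r hr))
  have hB' : ∀ χ : AddChar G ℂ, χ ≠ 1 → ((B' χ).card : ℝ) ≤ (Fintype.card G : ℝ) ^ k *
      (Real.exp (r ^ 2 * η) * (1 / orderOf χ + 1 / r)) ^ k := by
    intro χ h1
    by_cases h2 : χ ^ 2 = 1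
    · simp only [B', h2, true_and]
      refine (card_sum_le_le_exp_mul_pow (fun x => 1 + (χ x).re) k (k * η) (r ^ 2)
        (sq_nonneg r)).trans (hlap χ _ (by positivity) ?_)
      rw [AddChar.sum_comp_neg_re_eq χ h1 h2 fun t => Real.exp (-(r ^ 2 * t))]
      exact AddChar.sum_exp_neg_one_sub_re_le χ r hr
    · simp only [B', h2, false_and, Finset.filter_false, Finset.card_empty, Nat.cast_zero]
      positivity
  calc _ ≤ (((Finset.univ.filter fun χ : AddChar G ℂ => χ ≠ 1).biUnion
          fun χ => B χ ∪ B' χ).card : ℝ) := by exact_mod_cast Finset.card_le_card hsub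
    _ ≤ ∑ χ : AddChar G ℂ with χ ≠ 1, ((B χ ∪ B' χ).card : ℝ) := by
        exact_mod_cast Finset.card_biUnion_le
    _ ≤ ∑ χ : AddChar G ℂ with χ ≠ 1, 2 * (Fintype.card G : ℝ) ^ k *
          (Real.exp (r ^ 2 * η) * (1 / orderOf χ + 1 / r)) ^ k := by
        refine Finset.sum_le_sum fun χ hχ => ?_
        have h1 := hB χ
        have h2 := hB' χ (Finset.mem_filter.mp hχ).2
        have h3 : ((B χ ∪ B' χ).card : ℝ) ≤ (B χ).card + (B' χ).card := by
          exact_mod_cast Finset.card_union_le _ _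
        linarith
    _ = _ := by rw [Finset.mul_sum]

lemma AddChar.sum_one_div_orderOf_pow_le (s : Finset G)
    (hs : AddSubgroup.closure (s : Set G) = ⊤) (k : ℕ) (θ : ℝ)
    (hd : (s.card : ℝ) ≤ (1 - θ) * k) (hk : 2 ≤ θ * k) :
    ∑ χ : AddChar G ℂ with χ ≠ 1, (1 / (orderOf χ : ℝ)) ^ k ≤ 4 * (2 : ℝ) ^ (-(θ * k)) := by
  classical
  have hmaps : ∀ χ ∈ Finset.univ.filter fun χ : AddChar G ℂ => χ ≠ 1,
      orderOf χ ∈ Finset.Ioc 1 (Fintype.card G) := by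
    intro χ hχ
    rw [Finset.mem_Ioc, ← AddChar.card_eq]
    refine ⟨?_, orderOf_le_card_univ⟩
    have h0 := orderOf_pos χ
    have h1 : orderOf χ ≠ 1 := fun h => (Finset.mem_filter.mp hχ).2 (orderOf_eq_one_iff.mp h)
    omega
  rw [← Finset.sum_fiberwise_of_maps_to hmaps]
  have hterm : ∀ m ∈ Finset.Ioc 1 (Fintype.card G),
      ∑ χ ∈ Finset.univ.filter (fun χ : AddChar G ℂ => χ ≠ 1) with orderOf χ = m,
        (1 / (orderOf χ : ℝ)) ^ k ≤ 4 * (2 : ℝ) ^ (-(θ * k)) * ((m : ℝ) ^ 2)⁻¹ := by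
    intro m hm
    have hm1 : 1 < m := (Finset.mem_Ioc.mp hm).1
    have hm2 : (2 : ℝ) ≤ m := by exact_mod_cast hm1
    have hm0 : (0 : ℝ) < m := by linarith
    have hcard : (((Finset.univ.filter (fun χ : AddChar G ℂ => χ ≠ 1)).filter
        fun χ => orderOf χ = m).card : ℝ) ≤ (m : ℝ) ^ s.card := by
      have h := AddChar.card_orderOf_eq_le s hs m (by omega)
      have h' : ((Finset.univ.filter (fun χ : AddChar G ℂ => χ ≠ 1)).filter
        fun χ => orderOf χ = m).card ≤ m ^ s.card :=
        (Finset.card_le_card (Finset.filter_subset_filter _ (Finset.filter_subset _ _))).trans h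
      exact_mod_cast h'
    calc _ = ∑ χ ∈ Finset.univ.filter (fun χ : AddChar G ℂ => χ ≠ 1) with orderOf χ = m,
          (1 / (m : ℝ)) ^ k :=
          Finset.sum_congr rfl fun χ hχ => by rw [(Finset.mem_filter.mp hχ).2]
      _ ≤ (m : ℝ) ^ s.card * (1 / (m : ℝ)) ^ k := by
          rw [Finset.sum_const, nsmul_eq_mul]
          gcongr
      _ = (m : ℝ) ^ ((s.card : ℝ) - k) := by
          rw [Real.rpow_sub hm0, Real.rpow_natCast, Real.rpow_natCast, one_div, inv_pow,
            div_eq_mul_inv]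
      _ ≤ (m : ℝ) ^ ((2 - θ * k) + -2) :=
          Real.rpow_le_rpow_of_exponent_le (by linarith) (by linarith)
      _ = (m : ℝ) ^ (2 - θ * k) * ((m : ℝ) ^ 2)⁻¹ := by
          rw [Real.rpow_add hm0, Real.rpow_neg hm0.le 2]
          norm_num
      _ ≤ (2 : ℝ) ^ (2 - θ * k) * ((m : ℝ) ^ 2)⁻¹ := by
          have := Real.rpow_le_rpow_of_nonpos (by norm_num) hm2 (by linarith : 2 - θ * k ≤ 0)
          gcongr
      _ = _ := by
          rw [sub_eq_add_neg, Real.rpow_add (by norm_num)]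
          norm_num
  refine (Finset.sum_le_sum hterm).trans ?_
  rw [← Finset.mul_sum]
  have hsq := sum_Ioc_inv_sq_le_sub (α := ℝ) one_ne_zero (Fintype.card_pos (α := G))
  have : (0 : ℝ) ≤ (Fintype.card G : ℝ)⁻¹ := by positivity
  push_cast at hsq
  refine mul_le_of_le_one_right (by positivity) (by linarith)

end FiniteAbelian

/-- The single-character bound splits into a small-order and a large-order contribution. -/
lemma exp_mul_add_pow_le (κ M m : ℝ) (hκ : 0 < κ) (hκ1 : κ ≤ 1 / 2) (hM : 0 < M) (hm : 0 < m)
    (k : ℕ) :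
    (Real.exp κ * (1 / m + 1 / (16 / κ * M))) ^ k ≤
      Real.exp (2 * κ) ^ k * (1 / m) ^ k + (1 / 2) ^ k * (1 / M ^ k) := by
  have h1 : 1 / (16 / κ * M) = κ / 16 * (1 / M) := by field_simp
  rw [h1]
  have he : Real.exp κ ≤ 2 := by
    have hlog : (2 : ℝ) = Real.exp (Real.log 2) := (Real.exp_log (by norm_num)).symm
    rw [hlog]
    have := Real.log_two_gt_d9
    exact Real.exp_le_exp.mpr (by linarith)
  have hM' : 0 < 1 / M := by positivity
  have hm' : 0 < 1 / m := by positivity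
  rcases le_total (1 / (16 * M)) (1 / m) with h | h
  · have h2 : Real.exp κ * (1 / m + κ / 16 * (1 / M)) ≤ Real.exp (2 * κ) * (1 / m) := by
      rw [show 2 * κ = κ + κ by ring, Real.exp_add, mul_assoc]
      have h3 : 1 / (16 * M) = 1 / M / 16 := by field_simp
      have h4 := Real.add_one_le_exp κ
      gcongr
      rw [h3] at h
      nlinarith
    have h5 := pow_le_pow_left₀ (by positivity) h2 k
    rw [mul_pow (Real.exp (2 * κ))] at h5
    refine h5.trans (le_add_of_nonneg_right (by positivity))
  · have h2 : Real.exp κ * (1 / m + κ / 16 * (1 / M)) ≤ 1 / 2 * (1 / M) := by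
      have h3 : 1 / (16 * M) = 1 / M / 16 := by field_simp
      rw [h3] at h
      have h4 : 1 / m + κ / 16 * (1 / M) ≤ 1 / 4 * (1 / M) := by nlinarith
      have := mul_le_mul he h4 (by positivity) (by norm_num)
      linarith
    have h5 := pow_le_pow_left₀ (by positivity) h2 k
    rw [mul_pow (1 / 2), one_div_pow M] at h5
    refine h5.trans (le_add_of_nonneg_left (by positivity))

/-- On a lower-density-`(1−ε)` set of group sizes, `k ≥ (1+δ)·d(G)` generators already give
`t_rel^*(G^-(Z)) ≤ C·|G|^{2/k}` (stated equivalently via the absolute spectral gap)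
with probability at least `1 − C·2^{−k/c}`. -/
theorem statement8 :
    ∀ ε : ℝ, 0 < ε → ε < 1 → ∀ δ : ℝ, 0 < δ →
    ∃ A : Set ℕ, ∃ c C : ℝ, 0 < c ∧ 0 < C ∧
      (1 - ε ≤ Filter.liminf
        (fun n : ℕ => (Nat.card ↥(A ∩ Set.Icc 1 n) : ℝ) / (n : ℝ)) Filter.atTop) ∧
      ∀ (G : Type) [AddCommGroup G] [Fintype G] [DecidableEq G],
        Fintype.card G ∈ A → 2 ≤ Fintype.card G →
        ∀ k : ℕ, (1 + δ) * (minGenAdd G : ℝ) ≤ (k : ℝ) →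
          1 - C * (2 : ℝ) ^ (-((k : ℝ) / c)) ≤
            tupleProb G k (fun Z =>
              C⁻¹ * (Fintype.card G : ℝ) ^ (-(2 / (k : ℝ))) ≤ absSpectralGap (cayP Z)) := by
  intro ε hε _ δ hδ
  obtain ⟨θ, hθ⟩ : ∃ θ : ℝ, θ = δ / (1 + δ) := ⟨_, rfl⟩
  have hθ0 : 0 < θ := by rw [hθ]; positivity
  have hθ1 : θ ≤ 1 := by rw [hθ, div_le_one (by positivity)]; linarith
  obtain ⟨κ, hκ⟩ : ∃ κ : ℝ, κ = θ * Real.log 2 / 4 := ⟨_, rfl⟩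
  have hlog0 := Real.log_two_gt_d9
  have hlog1 := Real.log_two_lt_d9
  have hκ0 : 0 < κ := by rw [hκ]; positivity
  have hκ1 : κ ≤ 1 / 2 := by rw [hκ]; nlinarith
  refine ⟨Set.univ, 2 / θ, 10 + 1024 / κ ^ 3, by positivity, by positivity, ?_, ?_⟩
  · have hev : (fun n : ℕ => (Nat.card ↥(Set.univ ∩ Set.Icc 1 n) : ℝ) / (n : ℝ)) =ᶠ[Filter.atTop]
        fun _ => (1 : ℝ) := by
      filter_upwards [Filter.eventually_gt_atTop 0] with n hn
      have : (n : ℝ) ≠ 0 := by positivity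
      simp [this]
    rw [Filter.liminf_congr hev, Filter.liminf_const]
    linarith
  intro G _ _ _ _ hG k hk
  classical
  obtain ⟨s, hsd, hs⟩ : ∃ s : Finset G, s.card = minGenAdd G ∧
      AddSubgroup.closure (s : Set G) = ⊤ :=
    Nat.sInf_mem (s := {n : ℕ | ∃ s : Finset G, s.card = n ∧
      AddSubgroup.closure (s : Set G) = ⊤}) ⟨_, Finset.univ, rfl, by simp⟩
  have hexp : -((k : ℝ) / (2 / θ)) = -(θ * k / 2) := by field_simp
  rw [hexp]
  set C : ℝ := 10 + 1024 / κ ^ 3 with hC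
  have hC10 : 10 ≤ C := by
    have : 0 < 1024 / κ ^ 3 := by positivity
    linarith
  set good : (Fin k → G) → Prop := fun Z =>
    C⁻¹ * (Fintype.card G : ℝ) ^ (-(2 / (k : ℝ))) ≤ absSpectralGap (cayP Z) with hgood
  rcases lt_or_ge (θ * k) 2 with hsmall | hlarge
  · have h1 : (2 : ℝ) ^ (-1 : ℝ) ≤ (2 : ℝ) ^ (-(θ * k / 2)) :=
      Real.rpow_le_rpow_of_exponent_le (by norm_num) (by linarith)
    rw [Real.rpow_neg_one] at h1
    have h2 : 0 ≤ tupleProb G k good := by unfold tupleProb; positivity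
    nlinarith
  have hk0 : 0 < k := by
    rcases Nat.eq_zero_or_pos k with h | h
    · simp [h] at hlarge
      linarith
    · exact h
  have hk0' : (0 : ℝ) < k := by exact_mod_cast hk0
  have hN2 : (2 : ℝ) ≤ Fintype.card G := by exact_mod_cast hG
  have hN : (0 : ℝ) < Fintype.card G := by linarith
  obtain ⟨M, hMdef⟩ : ∃ M : ℝ, M = (Fintype.card G : ℝ) ^ (1 / (k : ℝ)) := ⟨_, rfl⟩
  have hM1 : 1 ≤ M := by
    rw [hMdef]
    exact Real.one_le_rpow (by linarith) (by positivity)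
  have hM0 : 0 < M := by linarith
  have hMk : M ^ k = Fintype.card G := by
    rw [hMdef, ← Real.rpow_natCast, ← Real.rpow_mul hN.le, one_div_mul_cancel hk0'.ne',
      Real.rpow_one]
  have hM2 : (Fintype.card G : ℝ) ^ (-(2 / (k : ℝ))) = (M ^ 2)⁻¹ := by
    rw [Real.rpow_neg hN.le, hMdef, ← Real.rpow_natCast, ← Real.rpow_mul hN.le]
    congr 2
    push_cast
    ring
  obtain ⟨r, hr⟩ : ∃ r : ℝ, r = 16 / κ * M := ⟨_, rfl⟩
  have hr0 : 0 < r := by rw [hr]; positivity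
  obtain ⟨η, hη⟩ : ∃ η : ℝ, η = κ ^ 3 / (256 * M ^ 2) := ⟨_, rfl⟩
  have hη0 : 0 ≤ η := by rw [hη]; positivity
  have hη1 : η ≤ 1 := by
    rw [hη, div_le_one (by positivity)]
    have : κ ^ 3 ≤ 1 := pow_le_one₀ hκ0.le (by linarith)
    nlinarith
  have hrη : r ^ 2 * η = κ := by rw [hr, hη]; field_simp; norm_num
  have himp : ∀ Z : Fin k → G, η / 4 ≤ absSpectralGap (cayP Z) → good Z := by
    intro Z hZ
    refine le_trans ?_ hZ
    rw [hM2]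
    have h1 : C⁻¹ ≤ κ ^ 3 / 1024 := by
      rw [show κ ^ 3 / 1024 = (1024 / κ ^ 3)⁻¹ by rw [inv_div]]
      exact inv_anti₀ (by positivity) (by linarith)
    have h2 : η / 4 = κ ^ 3 / 1024 * (M ^ 2)⁻¹ := by rw [hη]; field_simp; norm_num
    rw [h2]
    gcongr
  have hθk : (s.card : ℝ) ≤ (1 - θ) * k := by
    rw [hsd, hθ, show 1 - δ / (1 + δ) = 1 / (1 + δ) by field_simp; ring, one_div,
      inv_mul_eq_div, le_div_iff₀ (by positivity)]
    linarith
  have hbad := card_absSpectralGap_lt_le hG hk0 r η hr0 hη0 hη1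
  have hsum : ∑ χ : AddChar G ℂ with χ ≠ 1,
      (Real.exp (r ^ 2 * η) * (1 / orderOf χ + 1 / r)) ^ k ≤ 5 * (2 : ℝ) ^ (-(θ * k / 2)) := by
    have h1 : ∀ χ : AddChar G ℂ, (Real.exp (r ^ 2 * η) * (1 / orderOf χ + 1 / r)) ^ k ≤
        Real.exp (2 * κ) ^ k * (1 / (orderOf χ : ℝ)) ^ k +
          (1 / 2) ^ k * (1 / Fintype.card G) := by
      intro χ
      rw [hrη, hr, ← hMk]
      exact exp_mul_add_pow_le κ M (orderOf χ) hκ0 hκ1 hM0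
        (by exact_mod_cast orderOf_pos χ) k
    refine (Finset.sum_le_sum fun χ _ => h1 χ).trans ?_
    rw [Finset.sum_add_distrib, ← Finset.mul_sum, Finset.sum_const, nsmul_eq_mul]
    have h2 := AddChar.sum_one_div_orderOf_pow_le s hs k θ hθk hlarge
    have h3 : Real.exp (2 * κ) ^ k = (2 : ℝ) ^ (θ * k / 2) := by
      rw [← Real.exp_nat_mul, Real.rpow_def_of_pos (by norm_num), hκ]
      congr 1
      ring
    have h4 : ((Finset.univ.filter fun χ : AddChar G ℂ => χ ≠ 1).card : ℝ) ≤ Fintype.card G := by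
      have := Finset.card_le_univ (Finset.univ.filter fun χ : AddChar G ℂ => χ ≠ 1)
      rw [AddChar.card_eq] at this
      exact_mod_cast this
    have h5 : ((1 : ℝ) / 2) ^ k ≤ (2 : ℝ) ^ (-(θ * k / 2)) := by
      rw [one_div, inv_pow, ← Real.rpow_natCast, ← Real.rpow_neg (by norm_num)]
      exact Real.rpow_le_rpow_of_exponent_le (by norm_num) (by nlinarith)
    have h6 : (2 : ℝ) ^ (θ * k / 2) * (4 * (2 : ℝ) ^ (-(θ * k))) =
        4 * (2 : ℝ) ^ (-(θ * k / 2)) := by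
      rw [mul_left_comm, ← Real.rpow_add (by norm_num)]
      congr 2
      ring
    have h7 : ((Finset.univ.filter fun χ : AddChar G ℂ => χ ≠ 1).card : ℝ) *
        ((1 / 2) ^ k * (1 / Fintype.card G)) ≤ (1 / 2) ^ k := by
      calc _ ≤ (Fintype.card G : ℝ) * ((1 / 2) ^ k * (1 / Fintype.card G)) := by gcongr
        _ = (1 / 2) ^ k := by field_simp
    have h8 := mul_le_mul_of_nonneg_left h2 (pow_nonneg (Real.exp_pos (2 * κ)).le k)
    rw [h3, h6] at h8
    rw [h3]
    linarith
  have htotal : (Fintype.card G : ℝ) ^ k ≤ (Nat.card {z : Fin k → G // good z} : ℝ) +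
      ((Finset.univ.filter fun z : Fin k → G => ¬ η / 4 ≤ absSpectralGap (cayP z)).card : ℝ) := by
    rw [Nat.subtype_card (Finset.univ.filter good) (by simp)]
    have h1 := Finset.card_filter_add_card_filter_not (s := (Finset.univ : Finset (Fin k → G)))
      (fun z => η / 4 ≤ absSpectralGap (cayP z))
    rw [Finset.card_univ, Fintype.card_fun, Fintype.card_fin] at h1
    have h2 : (Finset.univ.filter fun z : Fin k → G => η / 4 ≤ absSpectralGap (cayP z)).card ≤
        (Finset.univ.filter good).card :=
      Finset.card_le_card (Finset.monotone_filter_right _ fun z _ hz => himp z hz)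
    exact_mod_cast h1.symm.le.trans (by omega)
  have hNk : 0 < (Fintype.card G : ℝ) ^ k := by positivity
  rw [tupleProb, le_div_iff₀ hNk]
  have hx : 0 < (2 : ℝ) ^ (-(θ * k / 2)) := by positivity
  have h1 := mul_le_mul_of_nonneg_left hsum (mul_pos two_pos hNk).le
  have h2 := mul_le_mul_of_nonneg_right hC10 (mul_pos hx hNk).le
  nlinarith
end

section
/- Let (k_N) be positive integers and (G_N) finite Abelian groups with k_N → ∞, k_N/log|G_N| → lambda for some lambda ∈ (0,∞), m_*(G_N) → ∞, and d(G_N) ≤ (1/4)·log|G_N|/log log|G_N| for every N. Then there exists a sequence omega_N → ∞ such that, setting M_*^± := min{M ∈ ℕ : |B_{k_N}^±(M)| ≥ |G_N|·e^{omega_N}}, drawing W uniformly from B_{k_N}^±(M_*^±) independently of Z_1,...,Z_{k_N} i.i.d. uniform on G_N, and setting W·Z := Σ_i W_i·Z_i, one has E_Z[ ||P(W·Z ∈ · | Z) − Unif(G_N)||_2^2 ] → 0 as N → ∞. -/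
open Filter

/-- `m_*(G)`: the maximum, over all decompositions of `G` as a direct sum of cyclic
groups `Z_{m_1} ⊕ ... ⊕ Z_{m_d}`, of `min_j m_j`. -/
noncomputable def mStarAdd (G : Type*) [AddCommGroup G] : ℕ :=
  sSup {t : ℕ | ∃ (d : ℕ) (m : Fin d → ℕ),
    Nonempty (G ≃+ ∀ j : Fin d, ZMod (m j)) ∧ ∀ j, t ≤ m j}

/-- Membership in the `L¹` lattice ball of radius `M` in dimension `k`
(undirected: `ℤ^k`; directed `undir = false`: `ℤ_{≥0}^k`). -/
def inBall (undir : Bool) {k : ℕ} (M : ℕ) (w : Fin k → ℤ) : Prop :=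
  (∑ i, (w i).natAbs) ≤ M ∧ (undir = false → ∀ i, 0 ≤ w i)

/-- Cardinality of the `L¹` lattice ball of radius `M` in dimension `k`. -/
noncomputable def latticeBallCard (undir : Bool) (k M : ℕ) : ℕ :=
  Nat.card {w : Fin k → ℤ // inBall undir M w}

/-- The law of `W·Z = Σᵢ Wᵢ·zᵢ` where `W` is uniform on the lattice ball of radius `M`,
for a fixed generator tuple `z`. -/
noncomputable def uniformBallLaw {G : Type*} [AddCommGroup G] [Fintype G] (undir : Bool)
    {k : ℕ} (z : Fin k → G) (M : ℕ) (x : G) : ℝ :=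
  (Nat.card {w : Fin k → ℤ // inBall undir M w ∧ (∑ i, w i • z i) = x} : ℝ) /
    (latticeBallCard undir k M : ℝ)

/-- `‖μ − Unif(G)‖₂² = |G|·Σ_x (μ(x) − 1/|G|)²`. -/
noncomputable def l2Unif {G : Type*} [Fintype G] (μ : G → ℝ) : ℝ :=
  (Fintype.card G : ℝ) * ∑ x, (μ x - (Fintype.card G : ℝ)⁻¹) ^ 2

open Classical in
/-- The `L¹` lattice ball of radius `M` in dimension `k`, as a finset. -/
noncomputable def latticeBall (undir : Bool) (k M : ℕ) : Finset (Fin k → ℤ) :=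
  (Fintype.piFinset fun _ => Finset.Icc (-(M : ℤ)) M).filter (inBall undir M)

section Ball

variable {undir : Bool} {k : ℕ}

theorem natAbs_le_of_inBall {M : ℕ} {w : Fin k → ℤ} (hw : inBall undir M w) (i : Fin k) :
    (w i).natAbs ≤ M :=
  (Finset.single_le_sum (f := fun i => (w i).natAbs) (fun _ _ => Nat.zero_le _)
    (Finset.mem_univ i)).trans hw.1

@[simp]
theorem mem_latticeBall {M : ℕ} {w : Fin k → ℤ} :
    w ∈ latticeBall undir k M ↔ inBall undir M w := by
  simp only [latticeBall, Finset.mem_filter, Fintype.mem_piFinset, Finset.mem_Icc,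
    and_iff_right_iff_imp]
  intro hw i
  have := natAbs_le_of_inBall hw i
  omega

theorem natCard_inBall_and (M : ℕ) (p : (Fin k → ℤ) → Prop) [DecidablePred p] :
    Nat.card {w : Fin k → ℤ // inBall undir M w ∧ p w} =
      ((latticeBall undir k M).filter p).card :=
  Nat.subtype_card _ fun w => by simp

theorem latticeBallCard_eq (undir : Bool) (k M : ℕ) :
    latticeBallCard undir k M = (latticeBall undir k M).card :=
  Nat.subtype_card _ fun w => by simp

theorem card_latticeBall_pos (M : ℕ) : 0 < (latticeBall undir k M).card :=
  Finset.card_pos.2 ⟨0, by simp [inBall]⟩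

theorem sum_natAbs_update (w : Fin k → ℤ) (i : Fin k) (a : ℤ) :
    (∑ l, (Function.update w i a l).natAbs) + (w i).natAbs =
      a.natAbs + ∑ l, (w l).natAbs := by
  rw [← Finset.add_sum_erase _ _ (Finset.mem_univ i),
    ← Finset.add_sum_erase _ (fun l => (w l).natAbs) (Finset.mem_univ i),
    Finset.sum_congr rfl fun l hl => by rw [Function.update_of_ne (Finset.ne_of_mem_erase hl)]]
  simp only [Function.update_self]
  ring

/-- Replacing the `i`-th coordinate of a point on a sphere by one of smaller modulus is
injective up to the sign of that coordinate. -/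
theorem sum_natAbs_coord_le (n : ℕ) (i : Fin k) :
    ∑ w ∈ (latticeBall undir k (n + 1)).filter (fun w => ∑ l, (w l).natAbs = n + 1),
      (w i).natAbs ≤ 2 * (latticeBall undir k n).card := by
  have h : (((latticeBall undir k (n + 1)).filter
      (fun w => ∑ l, (w l).natAbs = n + 1)).sigma
        fun w => Finset.range (w i).natAbs).card ≤
      (latticeBall undir k n ×ˢ (Finset.univ : Finset Bool)).card := by
    refine Finset.card_le_card_of_injOn
      (fun p => (Function.update p.1 i (if 0 < p.1 i then (p.2 : ℤ) else -p.2),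
        decide (0 < p.1 i))) ?_ ?_
    · rintro ⟨w, t⟩ hp
      simp only [Finset.coe_sigma, Set.mem_sigma_iff, Finset.mem_coe, Finset.mem_filter,
        mem_latticeBall, Finset.mem_range] at hp
      obtain ⟨⟨hw, hs⟩, ht⟩ := hp
      simp only [Finset.mem_coe, Finset.mem_product, mem_latticeBall, Finset.mem_univ, and_true]
      refine ⟨?_, fun hu l => ?_⟩
      · have := sum_natAbs_update w i (if 0 < w i then (t : ℤ) else -t)
        have h2 : (if 0 < w i then (t : ℤ) else -t).natAbs = t := by split_ifs <;> simp
        omega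
      · by_cases hl : l = i
        · subst hl
          have := hw.2 hu l
          rw [Function.update_self, if_pos (by omega)]
          omega
        · rw [Function.update_of_ne hl]
          exact hw.2 hu l
    · rintro ⟨w, t⟩ hp ⟨v, s⟩ hq heq
      simp only [Finset.coe_sigma, Set.mem_sigma_iff, Finset.mem_coe, Finset.mem_filter,
        mem_latticeBall, Finset.mem_range] at hp hq
      simp only [Prod.mk.injEq, decide_eq_decide] at heq
      obtain ⟨heq, hsgn⟩ := heq
      have hoff : ∀ l, l ≠ i → w l = v l := fun l hl => by
        have := congrFun heq l
        rwa [Function.update_of_ne hl, Function.update_of_ne hl] at this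
      have habs : (w i).natAbs = (v i).natAbs := by
        have h1 := hp.1.2
        have h2 := hq.1.2
        rw [← Finset.add_sum_erase _ _ (Finset.mem_univ i)] at h1 h2
        rw [Finset.sum_congr rfl fun l hl => by rw [hoff l (Finset.ne_of_mem_erase hl)]] at h1
        omega
      have hi : w i = v i := by omega
      have hwv : w = v := funext fun l => by
        by_cases hl : l = i
        · rw [hl, hi]
        · exact hoff l hl
      subst hwv
      have := congrFun heq i
      simp only [Function.update_self] at this
      have hts : t = s := by split_ifs at this <;> omega
      rw [hts]
  rw [Finset.card_sigma, Finset.card_product] at h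
  simpa [mul_comm] using h

theorem card_latticeBall_succ_mul_le (n : ℕ) :
    (n + 1) * (latticeBall undir k (n + 1)).card ≤
      (n + 1 + 2 * k) * (latticeBall undir k n).card := by
  set S := (latticeBall undir k (n + 1)).filter (fun w => ∑ l, (w l).natAbs = n + 1) with hS
  have h1 : (n + 1) * S.card ≤ 2 * k * (latticeBall undir k n).card := by
    calc (n + 1) * S.card = ∑ w ∈ S, ∑ i, (w i).natAbs := by
          rw [Finset.sum_congr rfl fun w hw => (Finset.mem_filter.1 hw).2]
          simp [hS, mul_comm]
      _ = ∑ i, ∑ w ∈ S, (w i).natAbs := Finset.sum_comm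
      _ ≤ ∑ _i : Fin k, 2 * (latticeBall undir k n).card :=
          Finset.sum_le_sum fun i _ => sum_natAbs_coord_le n i
      _ = _ := by simp; ring
  have h2 : (latticeBall undir k (n + 1)).card ≤ S.card + (latticeBall undir k n).card := by
    rw [← Finset.card_filter_add_card_filter_not
      (s := latticeBall undir k (n + 1)) (fun w => ∑ l, (w l).natAbs = n + 1)]
    refine Nat.add_le_add_left (Finset.card_le_card fun w hw => ?_) _
    simp only [Finset.mem_filter, mem_latticeBall] at hw ⊢
    have := hw.1.1
    exact ⟨by omega, hw.1.2⟩
  nlinarith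

theorem card_latticeBall_le_choose (n : ℕ) :
    (latticeBall undir k n).card ≤ (n + 2 * k).choose (2 * k) := by
  induction n with
  | zero =>
    rw [zero_add, Nat.choose_self, Finset.card_le_one]
    have h0 : ∀ w ∈ latticeBall undir k 0, w = 0 := fun w hw => funext fun i => by
      have := natAbs_le_of_inBall (mem_latticeBall.1 hw) i
      simpa using this
    intro a ha b hb
    rw [h0 a ha, h0 b hb]
  | succ n ih =>
    have h1 := card_latticeBall_succ_mul_le (undir := undir) (k := k) n
    have h2 := Nat.choose_mul_succ_eq (n + 2 * k) (2 * k)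
    rw [show n + 2 * k + 1 - 2 * k = n + 1 by omega] at h2
    rw [show n + 1 + 2 * k = n + 2 * k + 1 by ring] at h1 ⊢
    refine Nat.le_of_mul_le_mul_left ?_ (Nat.succ_pos n)
    calc _ ≤ _ := h1
      _ ≤ (n + 2 * k + 1) * (n + 2 * k).choose (2 * k) := Nat.mul_le_mul_left _ ih
      _ = _ := by rw [mul_comm, h2, mul_comm]

theorem card_latticeBall_le_two_pow (n : ℕ) :
    (latticeBall undir k n).card ≤ 2 ^ (n + 2 * k) :=
  (card_latticeBall_le_choose n).trans (Nat.choose_le_two_pow _ _)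

theorem two_pow_mul_card_latticeBall_add_le {M : ℕ} (hM : 4 * k ≤ M) (j : ℕ) :
    2 ^ j * (latticeBall undir k (M + j)).card ≤ 3 ^ j * (latticeBall undir k M).card := by
  induction j with
  | zero => simp
  | succ j ih =>
    have h1 := card_latticeBall_succ_mul_le (undir := undir) (k := k) (M + j)
    have h2 : 2 * (latticeBall undir k (M + j + 1)).card ≤
        3 * (latticeBall undir k (M + j)).card := by
      refine Nat.le_of_mul_le_mul_left ?_ (Nat.succ_pos (M + j))
      have h3 : 2 * (M + j + 1 + 2 * k) ≤ 3 * (M + j + 1) := by omega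
      calc _ = 2 * ((M + j + 1) * (latticeBall undir k (M + j + 1)).card) := by
            rw [Nat.succ_eq_add_one]; ring
        _ ≤ 2 * ((M + j + 1 + 2 * k) * (latticeBall undir k (M + j)).card) :=
            Nat.mul_le_mul_left _ h1
        _ = 2 * (M + j + 1 + 2 * k) * (latticeBall undir k (M + j)).card := by ring
        _ ≤ 3 * (M + j + 1) * (latticeBall undir k (M + j)).card := Nat.mul_le_mul_right _ h3
        _ = _ := by rw [Nat.succ_eq_add_one]; ring
    calc 2 ^ (j + 1) * (latticeBall undir k (M + (j + 1))).card
        = 2 ^ j * (2 * (latticeBall undir k (M + j + 1)).card) := by rw [pow_succ]; ring_nf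
      _ ≤ 2 ^ j * (3 * (latticeBall undir k (M + j)).card) := Nat.mul_le_mul_left _ h2
      _ = 3 * (2 ^ j * (latticeBall undir k (M + j)).card) := by ring
      _ ≤ 3 * (3 ^ j * (latticeBall undir k M).card) := Nat.mul_le_mul_left _ ih
      _ = _ := by rw [pow_succ]; ring

theorem pow_le_card_latticeBall (C : ℕ) :
    (C + 1) ^ k ≤ (latticeBall undir k (C * k)).card := by
  have h : (Fintype.piFinset fun _ : Fin k => Finset.range (C + 1)).card ≤
      (latticeBall undir k (C * k)).card := by
    refine Finset.card_le_card_of_injOn (fun w i => (w i : ℤ)) ?_ ?_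
    · intro w hw
      simp only [Finset.mem_coe, Fintype.mem_piFinset, Finset.mem_range] at hw
      simp only [Finset.mem_coe, mem_latticeBall]
      refine ⟨?_, fun _ i => by simp⟩
      calc ∑ i, ((w i : ℤ)).natAbs ≤ ∑ _i : Fin k, C :=
            Finset.sum_le_sum fun i _ => by simpa using Nat.lt_succ_iff.1 (hw i)
        _ = C * k := by simp [mul_comm]
    · intro w _ v _ h
      funext i
      simpa using congrFun h i
  simpa using h

/-- Adding `0`-`1` vectors to a residue class modulo `g ≥ 2` produces no coincidences. -/
theorem two_pow_mul_card_congr_le {M g : ℕ} (hg : 2 ≤ g) (v : Fin k → ℤ) :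
    2 ^ k * ((latticeBall undir k M).filter (fun w => ∀ i, (g : ℤ) ∣ w i - v i)).card ≤
      (latticeBall undir k (M + k)).card := by
  have h : ((Fintype.piFinset fun _ : Fin k => Finset.range 2) ×ˢ
      (latticeBall undir k M).filter (fun w => ∀ i, (g : ℤ) ∣ w i - v i)).card ≤
      (latticeBall undir k (M + k)).card := by
    refine Finset.card_le_card_of_injOn (fun p i => p.2 i + (p.1 i : ℤ)) ?_ ?_
    · rintro ⟨t, w⟩ hp
      simp only [Finset.coe_product, Set.mem_prod, Finset.mem_coe, Fintype.mem_piFinset,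
        Finset.mem_range, Finset.mem_filter, mem_latticeBall] at hp
      obtain ⟨ht, hw, -⟩ := hp
      simp only [Finset.mem_coe, mem_latticeBall]
      refine ⟨?_, fun hu i => add_nonneg (hw.2 hu i) (by simp)⟩
      calc ∑ i, (w i + (t i : ℤ)).natAbs ≤ ∑ i, ((w i).natAbs + 1) :=
            Finset.sum_le_sum fun i _ => by have := ht i; omega
        _ = (∑ i, (w i).natAbs) + k := by simp [Finset.sum_add_distrib]
        _ ≤ M + k := Nat.add_le_add_right hw.1 _
    · rintro ⟨t, w⟩ hp ⟨s, u⟩ hq heq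
      simp only [Finset.coe_product, Set.mem_prod, Finset.mem_coe, Fintype.mem_piFinset,
        Finset.mem_range, Finset.mem_filter] at hp hq
      have key : ∀ i, w i = u i ∧ t i = s i := fun i => by
        have h1 : w i + (t i : ℤ) = u i + (s i : ℤ) := congrFun heq i
        have h2 : (g : ℤ) ∣ w i - u i := by
          have := dvd_sub (hp.2.2 i) (hq.2.2 i)
          simpa using this
        have h3 := hp.1 i
        have h4 := hq.1 i
        have h5 : w i - u i = 0 := Int.eq_zero_of_abs_lt_dvd h2 (by rw [abs_lt]; omega)
        omega
      exact Prod.ext (funext fun i => (key i).2) (funext fun i => (key i).1)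
  simpa using h

theorem card_congr_le_card_latticeBall_div {M g : ℕ} (hg : 0 < g) {v : Fin k → ℤ}
    (hv : inBall undir M v) :
    ((latticeBall undir k M).filter (fun w => ∀ i, (g : ℤ) ∣ w i - v i)).card ≤
      (latticeBall true k (2 * M / g)).card := by
  refine Finset.card_le_card_of_injOn (fun w i => (w i - v i) / g) ?_ ?_
  · intro w hw
    simp only [Finset.mem_coe, Finset.mem_filter, mem_latticeBall] at hw
    simp only [Finset.mem_coe, mem_latticeBall]
    refine ⟨?_, fun h => by simp at h⟩
    rw [Nat.le_div_iff_mul_le hg, Finset.sum_mul]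
    calc ∑ i, ((w i - v i) / (g : ℤ)).natAbs * g = ∑ i, (w i - v i).natAbs :=
          Finset.sum_congr rfl fun i _ => by
            conv_rhs => rw [← Int.ediv_mul_cancel (hw.2 i), Int.natAbs_mul, Int.natAbs_natCast]
      _ ≤ ∑ i, ((w i).natAbs + (v i).natAbs) := Finset.sum_le_sum fun i _ => by omega
      _ ≤ 2 * M := by
          rw [Finset.sum_add_distrib, two_mul]
          exact Nat.add_le_add hw.1.1 hv.1
  · intro w hw u hu heq
    simp only [Finset.mem_coe, Finset.mem_filter] at hw hu
    funext i
    have h1 : (w i - v i) / (g : ℤ) = (u i - v i) / g := congrFun heq i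
    have h2 := Int.ediv_mul_cancel (hw.2 i)
    rw [h1, Int.ediv_mul_cancel (hu.2 i)] at h2
    omega

end Ball

section Group

variable {G : Type*} [AddCommGroup G]

theorem exists_card_eq_minGenAdd [Finite G] :
    ∃ s : Finset G, s.card = minGenAdd G ∧ AddSubgroup.closure (s : Set G) = ⊤ := by
  have := Fintype.ofFinite G
  exact Nat.sInf_mem (s := {n : ℕ | ∃ s : Finset G, s.card = n ∧
    AddSubgroup.closure (s : Set G) = ⊤}) ⟨_, Finset.univ, rfl, by simp⟩

/-- `G` is covered by `g ^ d(G)` translates of any subset containing `g • G`. -/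
theorem card_le_pow_minGenAdd_mul [Fintype G] {g : ℕ} (hg : 0 < g) (H : AddSubgroup G)
    (hH : ∀ x : G, (g : ℤ) • x ∈ H) :
    Nat.card G ≤ g ^ minGenAdd G * Nat.card H := by
  obtain ⟨s, hs, hgen⟩ := exists_card_eq_minGenAdd (G := G)
  have hsurj : Function.Surjective
      (fun p : (s → Fin g) × H => (∑ a, ((p.1 a : ℕ) : ℤ) • (a : G)) + p.2) := by
    intro x
    have hx : x ∈ Submodule.span ℤ (s : Set G) := by
      rw [← Submodule.mem_toAddSubgroup, Submodule.span_int_eq_addSubgroupClosure, hgen]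
      trivial
    obtain ⟨f, rfl⟩ := Submodule.mem_span_finset'.1 hx
    have hg' : (0 : ℤ) < g := by exact_mod_cast hg
    refine ⟨(fun a => ⟨(f a % g).toNat, ?_⟩,
      ⟨(g : ℤ) • ∑ a, (f a / g) • (a : G), hH _⟩), ?_⟩
    · have := Int.emod_lt_of_pos (f a) hg'
      omega
    · simp only [Finset.smul_sum, ← Finset.sum_add_distrib]
      refine Finset.sum_congr rfl fun a _ => ?_
      rw [Int.toNat_of_nonneg (Int.emod_nonneg _ hg'.ne'), smul_smul, ← add_smul,
        Int.emod_add_mul_ediv]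
  have := Nat.card_le_card_of_surjective _ hsurj
  rwa [Nat.card_prod, Nat.card_fun, Nat.card_eq_fintype_card (α := s), Fintype.card_coe, hs,
    Nat.card_fin] at this

theorem card_sum_smul_eq_zero_mul_le [Fintype G] [DecidableEq G] {k g : ℕ} (hg : 0 < g)
    {v a : Fin k → ℤ} (hv : ∑ i, a i * v i = g) :
    (Finset.univ.filter fun z : Fin k → G => ∑ i, v i • z i = 0).card * Fintype.card G ≤
      g ^ minGenAdd G * Fintype.card G ^ k := by
  let f : (Fin k → G) →+ G :=
    { toFun := fun z => ∑ i, v i • z i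
      map_zero' := by simp
      map_add' := by simp [Finset.sum_add_distrib] }
  have hker : Nat.card f.ker =
      (Finset.univ.filter fun z : Fin k → G => ∑ i, v i • z i = 0).card :=
    Nat.subtype_card _ fun z => by simp [f, AddMonoidHom.mem_ker]
  have hrange := card_le_pow_minGenAdd_mul hg f.range fun x =>
    ⟨fun i => a i • x, by simp [f, smul_smul, ← Finset.sum_smul, ← hv, mul_comm]⟩
  have hmul := f.ker.card_mul_index
  rw [AddSubgroup.index_ker] at hmul
  simp only [Nat.card_eq_fintype_card (α := Fin k → G), Fintype.card_fun, Fintype.card_fin] at hmul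
  rw [← hker, ← hmul, ← Nat.card_eq_fintype_card (α := G)]
  calc _ ≤ Nat.card f.ker * (g ^ minGenAdd G * Nat.card f.range) := Nat.mul_le_mul_left _ hrange
    _ = _ := by ring

theorem card_sum_smul_eq_mul_le [Fintype G] [DecidableEq G] {undir : Bool} {k M : ℕ}
    {w v : Fin k → ℤ} (hw : inBall undir M w) (hv : inBall undir M v) :
    (Finset.univ.filter fun z : Fin k → G => ∑ i, w i • z i = ∑ i, v i • z i).card *
        Fintype.card G ≤
      ((if w = v then Fintype.card G else 0) + 1 +
        ∑ g ∈ Finset.Icc 2 (2 * M), if ∀ i, (g : ℤ) ∣ w i - v i then g ^ minGenAdd G else 0) *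
        Fintype.card G ^ k := by
  by_cases hwv : w = v
  · subst hwv
    simp only [Finset.filter_true, if_true, Finset.card_univ, Fintype.card_fun, Fintype.card_fin]
    rw [mul_comm]
    exact Nat.mul_le_mul_right _ (by omega)
  rw [if_neg hwv, zero_add]
  obtain ⟨j, hj⟩ : ∃ j, w j - v j ≠ 0 := by
    by_contra! h
    exact hwv (funext fun i => sub_eq_zero.1 (h i))
  obtain ⟨a, ha⟩ := Finset.gcd_eq_sum_mul Finset.univ fun i => w i - v i
  set d := Finset.univ.gcd fun i => w i - v i with hd
  have hdvd : ∀ i, d ∣ w i - v i := fun i => Finset.gcd_dvd (Finset.mem_univ i)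
  have hd0 : 0 ≤ d := by
    have : normalize d = d := Finset.normalize_gcd
    rw [← this]
    exact Int.nonneg_of_normalize_eq_self (normalize_idem _)
  obtain ⟨g, hgd⟩ := Int.eq_ofNat_of_zero_le hd0
  rw [hgd] at hdvd
  have hg : 0 < g := by
    rcases Nat.eq_zero_or_pos g with rfl | h
    · exact absurd (by simpa using hdvd j) hj
    · exact h
  have hgM : g ≤ 2 * M := by
    have h1 := Int.le_of_dvd (abs_pos.2 hj) ((dvd_abs _ _).2 (hdvd j))
    rw [Int.abs_eq_natAbs] at h1
    have h2 := natAbs_le_of_inBall hw j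
    have h3 := natAbs_le_of_inBall hv j
    omega
  have h := card_sum_smul_eq_zero_mul_le (G := G) hg (v := fun i => w i - v i) (a := a)
    (by rw [← hgd, ha]; exact Finset.sum_congr rfl fun i _ => mul_comm _ _)
  simp only [sub_smul, Finset.sum_sub_distrib, sub_eq_zero] at h
  refine h.trans (Nat.mul_le_mul_right _ ?_)
  rcases Nat.lt_or_ge g 2 with h1 | h2
  · obtain rfl : g = 1 := by omega
    simp
  · refine le_add_left ?_
    have := Finset.single_le_sum (s := Finset.Icc 2 (2 * M))
      (f := fun g : ℕ => if ∀ i, (g : ℤ) ∣ w i - v i then g ^ minGenAdd G else 0)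
      (fun _ _ => Nat.zero_le _) (Finset.mem_Icc.2 ⟨h2, hgM⟩)
    simpa [hdvd] using this

end Group

section Expectation

theorem l2Unif_nonneg {G : Type*} [Fintype G] (μ : G → ℝ) : 0 ≤ l2Unif μ :=
  mul_nonneg (Nat.cast_nonneg _) (Finset.sum_nonneg fun _ _ => sq_nonneg _)

variable {G : Type*} [AddCommGroup G] [Fintype G]

theorem l2Unif_eq {μ : G → ℝ} (hμ : ∑ x, μ x = 1) :
    l2Unif μ = (Fintype.card G : ℝ) * ∑ x, μ x ^ 2 - 1 := by
  have hG : (Fintype.card G : ℝ) ≠ 0 := Nat.cast_ne_zero.2 Fintype.card_ne_zero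
  have : ∑ x, (μ x - (Fintype.card G : ℝ)⁻¹) ^ 2 =
      ∑ x, μ x ^ 2 - (Fintype.card G : ℝ)⁻¹ := by
    simp only [sub_sq, Finset.sum_add_distrib, Finset.sum_sub_distrib, ← Finset.sum_mul,
      ← Finset.mul_sum, hμ, Finset.sum_const, Finset.card_univ, nsmul_eq_mul]
    field_simp
    ring
  rw [l2Unif, this, mul_sub, mul_inv_cancel₀ hG]

open Classical in
theorem uniformBallLaw_eq (undir : Bool) {k : ℕ} (z : Fin k → G) (M : ℕ) (x : G) :
    uniformBallLaw undir z M x =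
      (((latticeBall undir k M).filter fun w => ∑ i, w i • z i = x).card : ℝ) /
        (latticeBall undir k M).card := by
  rw [uniformBallLaw, latticeBallCard_eq,
    natCard_inBall_and M fun w : Fin k → ℤ => ∑ i, w i • z i = x]

open Classical in
theorem l2Unif_uniformBallLaw (undir : Bool) {k : ℕ} (z : Fin k → G) (M : ℕ) :
    l2Unif (uniformBallLaw undir z M) =
      (Fintype.card G : ℝ) * (∑ v ∈ latticeBall undir k M, ∑ w ∈ latticeBall undir k M,
        if ∑ i, w i • z i = ∑ i, v i • z i then 1 else 0) /
        ((latticeBall undir k M).card : ℝ) ^ 2 - 1 := by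
  have hb : ((latticeBall undir k M).card : ℝ) ≠ 0 :=
    Nat.cast_ne_zero.2 (card_latticeBall_pos M).ne'
  have h1 : ∑ x, uniformBallLaw undir z M x = 1 := by
    simp only [uniformBallLaw_eq, ← Finset.sum_div, ← Nat.cast_sum]
    rw [← Finset.card_eq_sum_card_fiberwise (s := latticeBall undir k M)
      (f := fun w => ∑ i, w i • z i) (t := Finset.univ) (fun _ _ => Finset.mem_univ _),
      div_self hb]
  rw [l2Unif_eq h1, mul_div_assoc]
  congr 2
  simp only [uniformBallLaw_eq, div_pow, ← Finset.sum_div]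
  congr 1
  rw [← Finset.sum_fiberwise (latticeBall undir k M) (fun v => ∑ i, v i • z i)]
  refine Finset.sum_congr rfl fun x _ => ?_
  rw [Finset.sum_congr rfl fun v hv => by rw [(Finset.mem_filter.1 hv).2]]
  simp [Finset.sum_boole, sq]

theorem expectation_l2Unif_le (undir : Bool) {k M : ℕ} {R : ℕ → ℕ}
    (hR : ∀ g ∈ Finset.Icc 2 (2 * M), ∀ v ∈ latticeBall undir k M,
      ((latticeBall undir k M).filter (fun w => ∀ i, (g : ℤ) ∣ w i - v i)).card ≤ R g) :
    (∑ z : Fin k → G, l2Unif (uniformBallLaw undir z M)) / (Fintype.card G : ℝ) ^ k ≤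
      ((Fintype.card G : ℝ) + ∑ g ∈ Finset.Icc 2 (2 * M), (g : ℝ) ^ minGenAdd G * R g) /
        (latticeBall undir k M).card := by
  classical
  set B := latticeBall undir k M with hB
  have hb : (0 : ℝ) < B.card := Nat.cast_pos.2 (card_latticeBall_pos M)
  have hG : (0 : ℝ) < Fintype.card G := Nat.cast_pos.2 Fintype.card_pos
  have hnat : Fintype.card G * ∑ z : Fin k → G, ∑ v ∈ B, ∑ w ∈ B,
      (if ∑ i, w i • z i = ∑ i, v i • z i then 1 else 0) ≤
      (B.card * (Fintype.card G + B.card + ∑ g ∈ Finset.Icc 2 (2 * M), g ^ minGenAdd G * R g)) *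
        Fintype.card G ^ k := by
    rw [Finset.sum_comm, Finset.mul_sum, mul_assoc, ← smul_eq_mul B.card]
    refine Finset.sum_le_card_nsmul _ _ _ fun v hv => ?_
    rw [Finset.sum_comm, Finset.mul_sum]
    calc ∑ w ∈ B, Fintype.card G * ∑ z : Fin k → G,
          (if ∑ i, w i • z i = ∑ i, v i • z i then 1 else 0)
        ≤ ∑ w ∈ B, ((if w = v then Fintype.card G else 0) + 1 + ∑ g ∈ Finset.Icc 2 (2 * M),
            if ∀ i, (g : ℤ) ∣ w i - v i then g ^ minGenAdd G else 0) * Fintype.card G ^ k := by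
          refine Finset.sum_le_sum fun w hw => ?_
          rw [← Finset.card_filter, mul_comm]
          exact card_sum_smul_eq_mul_le (mem_latticeBall.1 hw) (mem_latticeBall.1 hv)
      _ = (Fintype.card G + B.card + ∑ g ∈ Finset.Icc 2 (2 * M), g ^ minGenAdd G *
            (B.filter (fun w => ∀ i, (g : ℤ) ∣ w i - v i)).card) * Fintype.card G ^ k := by
          rw [← Finset.sum_mul, Finset.sum_add_distrib, Finset.sum_add_distrib,
            Finset.sum_ite_eq' B v, if_pos hv, Finset.sum_comm]
          simp [Finset.sum_ite, mul_comm]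
      _ ≤ _ := by
          refine Nat.mul_le_mul_right _ (Nat.add_le_add_left (Finset.sum_le_sum fun g hg => ?_) _)
          exact Nat.mul_le_mul_left _ (hR g hg v hv)
  have hreal : (Fintype.card G : ℝ) * ∑ z : Fin k → G, ∑ v ∈ B, ∑ w ∈ B,
      (if ∑ i, w i • z i = ∑ i, v i • z i then (1 : ℝ) else 0) ≤
      (B.card * (Fintype.card G + B.card +
        ∑ g ∈ Finset.Icc 2 (2 * M), (g : ℝ) ^ minGenAdd G * R g)) *
        (Fintype.card G : ℝ) ^ k := by
    exact_mod_cast hnat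
  simp only [l2Unif_uniformBallLaw, Finset.sum_sub_distrib, ← Finset.sum_div, ← Finset.mul_sum]
  rw [← hB, div_le_iff₀ (pow_pos hG k), Finset.sum_const, Finset.card_univ, Fintype.card_fun,
    Fintype.card_fin, nsmul_one, Nat.cast_pow, sub_le_iff_le_add, div_le_iff₀ (pow_pos hb 2)]
  refine hreal.trans (le_of_eq ?_)
  field_simp
  ring

end Expectation

theorem expectation_l2Unif_minRadius_le {G : Type*} [AddCommGroup G] [Fintype G]
    (undir : Bool) {k C : ℕ}
    (hsize : (Fintype.card G : ℝ) * 64 ^ k ≤ (C + 1) ^ k)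
    (hsmall : (C : ℝ) ^ minGenAdd G ≤ (7 / 6) ^ k)
    (hlarge : (2 * C * k : ℝ) ^ minGenAdd G ≤ Fintype.card G) :
    (∑ z : Fin k → G, l2Unif (uniformBallLaw undir z
      (sInf {M : ℕ | (Fintype.card G : ℝ) * 64 ^ k ≤ (latticeBallCard undir k M : ℝ)}))) /
        (Fintype.card G : ℝ) ^ k ≤ (2 * C * k + 1) * (7 / 8) ^ k := by
  set S := {M : ℕ | (Fintype.card G : ℝ) * 64 ^ k ≤ (latticeBallCard undir k M : ℝ)} with hS
  have hCS : C * k ∈ S := by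
    simp only [hS, Set.mem_ofPred_eq, latticeBallCard_eq]
    exact hsize.trans (by exact_mod_cast pow_le_card_latticeBall C)
  have hMC : sInf S ≤ C * k := Nat.sInf_le hCS
  have hMS : sInf S ∈ S := Nat.sInf_mem ⟨_, hCS⟩
  set M := sInf S
  have hM : (Fintype.card G : ℝ) * 64 ^ k ≤ (latticeBall undir k M).card := by
    simpa only [hS, Set.mem_ofPred_eq, latticeBallCard_eq] using hMS
  set b := (latticeBall undir k M).card with hb
  have hb0 : (0 : ℝ) < b := Nat.cast_pos.2 (card_latticeBall_pos M)
  have hG1 : (1 : ℝ) ≤ Fintype.card G := Nat.one_le_cast.2 Fintype.card_pos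
  have hMk : 4 * k ≤ M := by
    by_contra! h
    have h1 : (64 : ℝ) ^ k ≤ b := (le_mul_of_one_le_left (by positivity) hG1).trans hM
    have h2 : 64 ^ k ≤ 2 ^ (M + 2 * k) :=
      (show 64 ^ k ≤ b by exact_mod_cast h1).trans (card_latticeBall_le_two_pow M)
    rw [show 64 = 2 ^ 6 by norm_num, ← pow_mul] at h2
    have := (Nat.pow_le_pow_iff_right (by norm_num)).1 h2
    omega
  have hgrowth : (2 : ℝ) ^ k * (latticeBall undir k (M + k)).card ≤ 3 ^ k * b := by
    exact_mod_cast two_pow_mul_card_latticeBall_add_le hMk k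
  let R : ℕ → ℕ := fun g =>
    if g ≤ C then (latticeBall undir k (M + k)).card / 2 ^ k else 2 ^ (4 * k)
  refine (expectation_l2Unif_le undir (R := R) fun g hg v hv => ?_).trans ?_
  · obtain ⟨hg2, -⟩ := Finset.mem_Icc.1 hg
    by_cases hgC : g ≤ C
    · simp only [R, if_pos hgC]
      rw [Nat.le_div_iff_mul_le (by positivity), mul_comm]
      exact two_pow_mul_card_congr_le hg2 v
    · simp only [R, if_neg hgC]
      refine (card_congr_le_card_latticeBall_div (by omega) (mem_latticeBall.1 hv)).trans
        ((card_latticeBall_le_two_pow _).trans (Nat.pow_le_pow_right (by norm_num) ?_))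
      have : 2 * M / g ≤ 2 * k := by
        refine Nat.div_le_of_le_mul ?_
        nlinarith
      omega
  · have hterm : ∀ g ∈ Finset.Icc 2 (2 * M),
        (g : ℝ) ^ minGenAdd G * R g ≤ (7 / 8) ^ k * b := by
      intro g hg
      obtain ⟨hg2, hgM⟩ := Finset.mem_Icc.1 hg
      by_cases hgC : g ≤ C
      · simp only [R, if_pos hgC]
        have h1 : (g : ℝ) ^ minGenAdd G ≤ (7 / 6) ^ k :=
          (pow_le_pow_left₀ (Nat.cast_nonneg _) (Nat.cast_le.2 hgC) _).trans hsmall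
        have h2 : (((latticeBall undir k (M + k)).card / 2 ^ k : ℕ) : ℝ) ≤ (3 / 4) ^ k * b := by
          refine Nat.cast_div_le.trans ?_
          rw [Nat.cast_pow, Nat.cast_ofNat, div_le_iff₀ (by positivity)]
          refine le_of_mul_le_mul_left (hgrowth.trans (le_of_eq ?_)) (pow_pos two_pos k)
          rw [show (2 : ℝ) ^ k * ((3 / 4) ^ k * b * 2 ^ k) = (2 ^ k * 2 ^ k * (3 / 4) ^ k) * b by
            ring, ← mul_pow, ← mul_pow]
          norm_num
        calc _ ≤ (7 / 6 : ℝ) ^ k * ((3 / 4) ^ k * b) := by gcongr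
          _ = _ := by rw [← mul_assoc, ← mul_pow]; norm_num
      · simp only [R, if_neg hgC]
        have h1 : (g : ℝ) ^ minGenAdd G ≤ Fintype.card G := by
          refine (pow_le_pow_left₀ (Nat.cast_nonneg _) ?_ _).trans hlarge
          rw [mul_assoc]
          exact_mod_cast hgM.trans (Nat.mul_le_mul_left 2 hMC)
        calc _ ≤ (Fintype.card G : ℝ) * (2 ^ (4 * k) : ℕ) := by gcongr
          _ = (1 / 4) ^ k * ((Fintype.card G : ℝ) * 64 ^ k) := by
            rw [mul_left_comm, ← mul_pow, pow_mul]
            norm_num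
          _ ≤ (7 / 8) ^ k * b :=
            mul_le_mul (pow_le_pow_left₀ (by norm_num) (by norm_num) k) hM
              (by positivity) (by positivity)
    have hcard : (Fintype.card G : ℝ) ≤ (7 / 8) ^ k * b :=
      calc (Fintype.card G : ℝ) = (1 / 64) ^ k * ((Fintype.card G : ℝ) * 64 ^ k) := by
            rw [mul_left_comm, ← mul_pow]
            norm_num
        _ ≤ (7 / 8) ^ k * b :=
            mul_le_mul (pow_le_pow_left₀ (by norm_num) (by norm_num) k) hM
              (by positivity) (by positivity)
    have hsum := Finset.sum_le_card_nsmul _ _ _ hterm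
    rw [nsmul_eq_mul, Nat.card_Icc] at hsum
    have hcount : ((2 * M + 1 - 2 : ℕ) : ℝ) ≤ 2 * C * k := by
      rw [mul_assoc]
      exact_mod_cast (show 2 * M + 1 - 2 ≤ 2 * (C * k) by omega)
    rw [div_le_iff₀ hb0]
    have : ((2 * M + 1 - 2 : ℕ) : ℝ) * ((7 / 8) ^ k * b) ≤ 2 * C * k * ((7 / 8) ^ k * b) := by
      gcongr
    linarith

theorem tendsto_affine_mul_pow_zero (A : ℝ) :
    Tendsto (fun k : ℕ => (A * k + 1) * (7 / 8 : ℝ) ^ k) atTop (nhds 0) := by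
  have h1 := tendsto_self_mul_const_pow_of_lt_one (r := (7 / 8 : ℝ)) (by norm_num) (by norm_num)
  have h2 := tendsto_pow_atTop_nhds_zero_of_lt_one (r := (7 / 8 : ℝ)) (by norm_num) (by norm_num)
  have := (h1.const_mul A).add h2
  simp only [mul_zero, add_zero] at this
  exact this.congr fun k => by ring

/-- In the regime `k ≍ log |G|`, `d(G) ≤ log |G| / (4 log log |G|)`, all the size conditions of
`expectation_l2Unif_minRadius_le` hold once `n = log |G|` is large. -/
theorem size_conditions {lam n c d k C : ℝ} (hlam : 0 < lam) (hC : 1 ≤ C) (hk : 0 < k)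
    (hc : Real.exp n = c) (hkn : k < 2 * lam * n) (hnk : n < 2 / lam * k)
    (hCexp : 64 * Real.exp (2 / lam) ≤ C) (hn : 4 * C * lam ≤ n) (hn1 : 1 < n)
    (hlog : Real.log C / (2 * lam * Real.log (7 / 6)) ≤ Real.log n)
    (hd0 : 0 ≤ d) (hd : d ≤ 1 / 4 * n / Real.log n) :
    c * (64 : ℝ) ^ k ≤ (C + 1) ^ k ∧ C ^ d ≤ (7 / 6) ^ k ∧ (2 * C * k) ^ d ≤ c := by
  have hlogn : 0 < Real.log n := Real.log_pos hn1
  have hdn : d * Real.log n ≤ 1 / 4 * n := (le_div_iff₀ hlogn).1 hd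
  have hlog76 : 0 < Real.log (7 / 6) := Real.log_pos (by norm_num)
  refine ⟨?_, ?_, ?_⟩
  · calc c * (64 : ℝ) ^ k ≤ Real.exp (2 / lam) ^ k * 64 ^ k := by
          rw [← hc, ← Real.exp_mul]
          gcongr
      _ = (64 * Real.exp (2 / lam)) ^ k := by
          rw [← Real.mul_rpow (Real.exp_pos _).le (by norm_num), mul_comm]
      _ ≤ (C + 1) ^ k := Real.rpow_le_rpow (by positivity) (by linarith) hk.le
  · rw [Real.rpow_def_of_pos (by linarith), Real.rpow_def_of_pos (by norm_num)]
    refine Real.exp_le_exp.2 ?_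
    rw [div_le_iff₀ (by positivity)] at hlog
    have h1 : lam * n < 2 * k := by
      have := mul_lt_mul_of_pos_left hnk hlam
      rwa [← mul_assoc, mul_div_cancel₀ _ hlam.ne'] at this
    calc Real.log C * d ≤ Real.log n * (2 * lam * Real.log (7 / 6)) * d := by gcongr
      _ = 2 * lam * Real.log (7 / 6) * (d * Real.log n) := by ring
      _ ≤ 2 * lam * Real.log (7 / 6) * (1 / 4 * n) := by gcongr
      _ = Real.log (7 / 6) * (1 / 2 * (lam * n)) := by ring
      _ ≤ Real.log (7 / 6) * k := by gcongr; linarith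
  · have h1 : 2 * C * k ≤ n ^ 2 := by nlinarith
    calc (2 * C * k) ^ d ≤ (n ^ 2) ^ d := Real.rpow_le_rpow (by positivity) h1 hd0
      _ = Real.exp (2 * (d * Real.log n)) := by
          rw [Real.rpow_def_of_pos (by positivity), Real.log_pow]
          push_cast
          ring_nf
      _ ≤ Real.exp n := Real.exp_le_exp.2 (by linarith)
      _ = c := hc

theorem statement15 :
    ∀ lambda : ℝ, 0 < lambda →
    ∀ (G : ℕ → Type) [∀ N, AddCommGroup (G N)] [∀ N, Fintype (G N)] (k : ℕ → ℕ),
      (∀ N, 0 < k N) →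
      Tendsto k atTop atTop →
      Tendsto (fun N => (k N : ℝ) / Real.log (Fintype.card (G N))) atTop (nhds lambda) →
      Tendsto (fun N => mStarAdd (G N)) atTop atTop →
      (∀ N, (minGenAdd (G N) : ℝ) ≤
        (1 / 4) * Real.log (Fintype.card (G N)) / Real.log (Real.log (Fintype.card (G N)))) →
      ∃ ω : ℕ → ℝ, Tendsto ω atTop atTop ∧
        ∀ undir : Bool,
          Tendsto (fun N =>
              (∑ z : Fin (k N) → G N, l2Unif (uniformBallLaw undir z
                (sInf {M : ℕ | (Fintype.card (G N) : ℝ) * Real.exp (ω N) ≤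
                  (latticeBallCard undir (k N) M : ℝ)}))) /
                (Fintype.card (G N) : ℝ) ^ (k N))
            atTop (nhds 0) := by
  intro lam hlam G _ _ k hkpos hk hratio _ hd
  refine ⟨fun N => k N * Real.log 64, ?_, fun undir => ?_⟩
  · exact (tendsto_natCast_atTop_atTop.comp hk).atTop_mul_const (Real.log_pos (by norm_num))
  set n : ℕ → ℝ := fun N => Real.log (Fintype.card (G N)) with hn
  set C : ℕ := ⌈64 * Real.exp (2 / lam)⌉₊ with hCdef
  have hCexp : 64 * Real.exp (2 / lam) ≤ C := Nat.le_ceil _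
  have hC : 0 < C := Nat.ceil_pos.2 (by positivity)
  have hkn : ∀ᶠ N in atTop, (k N : ℝ) < 2 * lam * n N ∧ n N < 2 / lam * k N ∧ 0 < n N := by
    filter_upwards [hratio.eventually (lt_mem_nhds (show lam / 2 < lam by linarith)),
      hratio.eventually (gt_mem_nhds (show lam < 2 * lam by linarith))] with N h1 h2
    have hkN : (0 : ℝ) < k N := Nat.cast_pos.2 (hkpos N)
    have hpos : 0 < n N := by
      by_contra! h
      have := div_nonpos_of_nonneg_of_nonpos hkN.le h
      linarith
    rw [lt_div_iff₀ hpos] at h1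
    rw [div_lt_iff₀ hpos] at h2
    refine ⟨h2, ?_, hpos⟩
    rw [div_mul_eq_mul_div, lt_div_iff₀ hlam]
    linarith
  have hntop : Tendsto n atTop atTop := by
    refine tendsto_atTop_mono' _ ?_
      ((tendsto_natCast_atTop_atTop.comp hk).atTop_div_const (show 0 < 2 * lam by positivity))
    filter_upwards [hkn] with N h
    rw [div_le_iff₀ (by positivity), mul_comm]
    exact h.1.le
  refine tendsto_of_tendsto_of_tendsto_of_le_of_le' tendsto_const_nhds
    ((tendsto_affine_mul_pow_zero (2 * C)).comp hk)
    (Eventually.of_forall fun N => div_nonneg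
      (Finset.sum_nonneg fun z _ => l2Unif_nonneg _) (by positivity)) ?_
  filter_upwards [hkn, hntop.eventually_ge_atTop (4 * C * lam), hntop.eventually_gt_atTop 1,
    (Real.tendsto_log_atTop.comp hntop).eventually_ge_atTop
      (Real.log C / (2 * lam * Real.log (7 / 6)))] with N h1 h2 h3 h4
  obtain ⟨hsize, hsmall, hlarge⟩ := size_conditions (d := minGenAdd (G N)) hlam
    (Nat.one_le_cast.2 hC) (Nat.cast_pos.2 (hkpos N))
    (Real.exp_log (Nat.cast_pos.2 (Fintype.card_pos (α := G N)))) h1.1 h1.2.1 hCexp h2 h3 h4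
    (Nat.cast_nonneg _) (hd N)
  simp only [Real.rpow_natCast] at hsize hsmall hlarge
  have hexp : Real.exp (k N * Real.log 64) = 64 ^ k N := by
    rw [Real.exp_nat_mul, Real.exp_log (by norm_num)]
  simp only [hexp]
  exact expectation_l2Unif_minRadius_le undir hsize hsmall hlarge
end
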